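/- arXiv:2208.09251 — 2 statements merged into one kernel-verified Lean document; each statement's English description precedes it below -/
import Mathlib

section
/- Let 1 < k < n and let A_{n,k} be the almost path graph on vertices [n+1]. The characteristic polynomial of the connected subgraph arrangement 𝒜_{A_{n,k}} is χ(𝒜_{A_{n,k}}, t) = (t − 1) · ∏_{i=k+1}^{n+1} (t − i) · ∏_{i=n−k+2}^{n} (t − i). -/
open Finset

/-- The linear form `∑_{i ∈ I} x_i` on `ℚ^n`. -/
noncomputable def linForm {n : ℕ} (I : Finset (Fin n)) : (Fin n → ℚ) →ₗ[ℚ] ℚ :=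
  ∑ i ∈ I, LinearMap.proj i

/-- `I` is a nonempty subset of vertices inducing a connected subgraph of `G`. -/
def ConnSet {n : ℕ} (G : SimpleGraph (Fin n)) (I : Finset (Fin n)) : Prop :=
  I.Nonempty ∧ (G.induce (↑I : Set (Fin n))).Connected

/-- The connected subgraph arrangement of `G`, as a set of hyperplanes of `ℚ^n`. -/
def csa {n : ℕ} (G : SimpleGraph (Fin n)) : Set (Submodule ℚ (Fin n → ℚ)) :=
  {H | ∃ I : Finset (Fin n), ConnSet G I ∧ H = LinearMap.ker (linForm I)}

/-- The almost path graph `A_{n,k}` (paper notation, vertices `1,…,n+1` realized as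
`Fin (n+1)` with `0,…,n`): a path `1–⋯–n` together with the edge `{k, n+1}`. -/
def almostPath (n k : ℕ) : SimpleGraph (Fin (n + 1)) :=
  SimpleGraph.fromRel (fun a b =>
    (a.val + 1 = b.val ∧ b.val < n) ∨ (a.val = k - 1 ∧ b.val = n))

/-- The path-with-triangle graph `Δ_{n,k}` (paper notation): a path `1–⋯–n` together
with the edges `{k, n+1}` and `{k+1, n+1}`. -/
def pathTriangle (n k : ℕ) : SimpleGraph (Fin (n + 1)) :=
  SimpleGraph.fromRel (fun a b =>
    (a.val + 1 = b.val ∧ b.val < n) ∨ (a.val = k - 1 ∧ b.val = n) ∨ (a.val = k ∧ b.val = n))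

/-- The module of `𝒜_G`-derivations `D(𝒜_G) ⊆ Der_ℚ(ℚ[x_1,…,x_n])`. -/
noncomputable def derModule {n : ℕ} (G : SimpleGraph (Fin n)) :
    Submodule (MvPolynomial (Fin n) ℚ)
      (Derivation ℚ (MvPolynomial (Fin n) ℚ) (MvPolynomial (Fin n) ℚ)) where
  carrier := {θ | ∀ I : Finset (Fin n), ConnSet G I →
    (∑ i ∈ I, MvPolynomial.X i) ∣ θ (∑ i ∈ I, MvPolynomial.X i)}
  add_mem' := by
    intro a b ha hb I hI
    rw [Derivation.add_apply]
    exact dvd_add (ha I hI) (hb I hI)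
  zero_mem' := by
    intro I hI
    simp
  smul_mem' := by
    intro c θ hθ I hI
    rw [Derivation.smul_apply, smul_eq_mul]
    exact (hθ I hI).mul_left c

open Classical in
/-- The hyperplanes of the connected subgraph arrangement of `G`, as a `Finset`. -/
noncomputable def csaFinset {n : ℕ} (G : SimpleGraph (Fin n)) :
    Finset (Submodule ℚ (Fin n → ℚ)) :=
  (Finset.univ.filter fun I : Finset (Fin n) => ConnSet G I).image fun I =>
    LinearMap.ker (linForm I)

/-- The characteristic polynomial of a (central) arrangement `A` in `ℚ^n`, via
Whitney's formula `χ(A,t) = ∑_{B ⊆ A} (-1)^{|B|} t^{dim ⋂ B}`, which agrees with the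
Möbius-function definition `χ(A,t) = ∑_{X ∈ L(A)} μ(ℚ^n, X) t^{dim X}`
(Orlik–Terao, Lemma 2.55). -/
noncomputable def charPoly {n : ℕ} (A : Finset (Submodule ℚ (Fin n → ℚ))) : Polynomial ℚ :=
  ∑ B ∈ A.powerset, ((-1 : ℚ) ^ B.card) •
    (Polynomial.X ^ (Module.finrank ℚ ↥(⨅ H ∈ B, H)))


section rankPart
variable {K : Type*} [Field K] {N : ℕ}

/-- Solutions over `K` of the integer linear equations in `S`. -/
noncomputable def solK (K : Type*) [Field K] {N : ℕ} (S : Set (Fin N → ℤ)) : Submodule K (Fin N → K) where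
  carrier := {x | ∀ v ∈ S, ∑ i, (v i : K) * x i = 0}
  add_mem' := by
    intro x y hx hy v hv
    simp only [Pi.add_apply, mul_add, Finset.sum_add_distrib, hx v hv, hy v hv, add_zero]
  zero_mem' := by intro v _; simp
  smul_mem' := by
    intro c x hx v hv
    have := hx v hv
    simp only [Pi.smul_apply, smul_eq_mul, mul_left_comm _ c, ← Finset.mul_sum, this, mul_zero]

theorem exists_rank (S : Set (Fin N → ℤ)) : ∃ (d : ℕ) (D : ℕ), D ≠ 0 ∧
    ∀ (K : Type) [Field K], (D : K) ≠ 0 → Module.finrank K (solK K S) = d := by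
  obtain ⟨r, snf⟩ := Submodule.smithNormalForm (Pi.basisFun ℤ (Fin N)) (Submodule.span ℤ S)
  have ha : ∀ i, snf.a i ≠ 0 := by
    intro i h
    have h1 := snf.snf i
    rw [h, zero_smul] at h1
    exact snf.bN.ne_zero i (Subtype.ext h1)
  refine ⟨N - r, (∏ i, snf.a i).natAbs, ?_, ?_⟩
  · simpa [Finset.prod_eq_zero_iff] using ha
  intro K _ hD
  have haK : ∀ i, (snf.a i : K) ≠ 0 := by
    intro i h
    apply hD
    have : ((∏ i, snf.a i : ℤ) : K) = 0 := by
      push_cast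
      exact Finset.prod_eq_zero (Finset.mem_univ i) h
    rcases Int.natAbs_eq (∏ i, snf.a i) with h2 | h2
    · rw [h2, Int.cast_natCast] at this; exact this
    · rw [h2, Int.cast_neg, Int.cast_natCast, neg_eq_zero] at this; exact this
  let e1 : (Fin N → K) ≃ₗ[K] ((Fin N → ℤ) →ₗ[ℤ] K) := (Pi.basisFun ℤ (Fin N)).constr K
  let e2 : (Fin N → K) ≃ₗ[K] ((Fin N → ℤ) →ₗ[ℤ] K) := snf.bM.constr K
  let e := e1.trans e2.symm
  have he1 : ∀ x v, e1 x v = ∑ i, (v i : K) * x i := by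
    intro x v
    simp [e1, Module.Basis.constr_apply_fintype]
  have key : solK K S = (LinearMap.ker (LinearMap.funLeft K K snf.f)).comap (e : (Fin N → K) →ₗ[K] (Fin N → K)) := by
    ext x
    obtain ⟨c, rfl⟩ : ∃ c, x = e.symm c := ⟨e x, by simp⟩
    have hφ : e1 (e.symm c) = e2 c := by simp [e]
    have h1 : e.symm c ∈ solK K S ↔ ∀ v ∈ S, e2 c v = 0 := by
      rw [← hφ]; simp only [he1]; rfl
    have h2 : (∀ v ∈ S, e2 c v = 0) ↔ ∀ v ∈ Submodule.span ℤ S, e2 c v = 0 := by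
      have : (∀ v ∈ S, e2 c v = 0) ↔ S ⊆ LinearMap.ker (e2 c) := by
        simp [Set.subset_def]
      rw [this, ← Submodule.span_le]
      simp [SetLike.le_def]
    have h3 : (∀ v ∈ Submodule.span ℤ S, e2 c v = 0) ↔ ∀ i, e2 c (snf.bN i : Fin N → ℤ) = 0 := by
      constructor
      · intro h i; exact h _ (snf.bN i).2
      · intro h v hv
        have : (e2 c).comp (Submodule.span ℤ S).subtype = 0 := by
          apply snf.bN.ext; intro i; simpa using h i
        exact LinearMap.congr_fun this ⟨v, hv⟩
    rw [h1, h2, h3]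
    simp only [snf.snf, map_smul]
    have h4 : ∀ i, e2 c (snf.bM (snf.f i)) = c (snf.f i) := by
      intro i; simp [e2]
    simp only [h4, Submodule.mem_comap, LinearMap.mem_ker, LinearEquiv.coe_coe, LinearEquiv.apply_symm_apply]
    rw [funext_iff]
    simp [zsmul_eq_mul, haK, LinearMap.funLeft_apply]
  have h5 : Module.finrank K (solK K S) = Module.finrank K (LinearMap.ker (LinearMap.funLeft K K snf.f)) := by
    rw [key]
    exact (LinearEquiv.ofSubmodule' e _).finrank_eq
  rw [h5]
  have h6 := LinearMap.finrank_range_add_finrank_ker (LinearMap.funLeft K K snf.f)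
  rw [LinearMap.range_eq_top.2 (LinearMap.funLeft_surjective_of_injective K K _ snf.f.injective)] at h6
  simp at h6
  omega

end rankPart

/-- Configurations of `a` left and `b` right points on the line with `m` places. -/
def Good {a b m : ℕ} (f : Fin a → Fin m) (g : Fin b → Fin m) : Prop :=
  Function.Injective f ∧ Function.Injective g ∧ (∀ i j, f i ≠ g j) ∧
    (∀ i j, (f i).val ≠ (g j).val + 1) ∧ ∀ j, (g j).val + 1 ≠ m

def Cfg (a b m : ℕ) : Type := {c : (Fin a → Fin m) × (Fin b → Fin m) // Good c.1 c.2}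

noncomputable instance (a b m : ℕ) : Fintype (Cfg a b m) := by
  classical
  unfold Cfg; infer_instance

theorem succAbove_val {m : ℕ} (r : Fin (m+1)) (x : Fin m) :
    (r.succAbove x).val = if x.val < r.val then x.val else x.val + 1 := by
  rw [Fin.succAbove]
  simp only [Fin.lt_def, Fin.val_castSucc]
  split_ifs <;> simp

theorem good_insert {a b m : ℕ} (f : Fin a → Fin m) (g : Fin b → Fin m) (r : Fin (m+1)) :
    Good (fun i => r.succAbove (f i)) (Fin.cons r (fun i => r.succAbove (g i)) : Fin (b+1) → Fin (m+1)) ↔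
      Good f g ∧ r ≠ Fin.last m ∧ ∀ i, r ≠ (f i).castSucc := by
  have hr := r.2
  simp only [Good, Fin.forall_fin_succ, Fin.cons_zero, Fin.cons_succ, succAbove_val, ne_eq,
    Function.Injective, Fin.ext_iff, Fin.val_last, Fin.val_castSucc]
  have hf := fun i => (f i).2
  have hg := fun i => (g i).2
  constructor
  · rintro ⟨h1, h2, h3, h4, h5⟩
    refine ⟨⟨?_, ?_, ?_, ?_, ?_⟩, ?_, ?_⟩
    · intro i j h; apply h1; rw [h]
    · intro i j h; have := (h2.2 i).2 j; simp [h] at this; simpa using this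
    · intro i j h; apply (h3 i).2 j; rw [h]
    · intro i j h; have := (h4 i).2 j; have := (h4 i).1; grind
    · intro j h; have := h5.2 j; grind
    · grind
    · intro i h; have := (h4 i).1; grind
  · rintro ⟨⟨h1, h2, h3, h4, h5⟩, h6, h7⟩
    refine ⟨?_, ?_, ?_, ?_, ?_⟩
    · intro i j h; apply h1; grind
    · refine ⟨⟨fun _ => trivial, ?_⟩, ?_⟩
      · intro j h; grind
      · intro i; refine ⟨?_, ?_⟩
        · intro h; grind
        · intro j h; have := @h2 i j (by grind); grind
    · intro i; refine ⟨by grind, ?_⟩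
      intro j h; apply h3 i j; grind
    · intro i; refine ⟨?_, ?_⟩
      · have := h7 i; grind
      · intro j h; have := h4 i j; have := h3 i j; have := h7 i; grind
    · refine ⟨by omega, ?_⟩
      intro j h; have := h5 j; grind

noncomputable def insEquiv (a b m : ℕ) : Cfg a (b+1) (m+1) ≃
    (Σ c : Cfg a b m, {r : Fin (m+1) // r ≠ Fin.last m ∧ ∀ i, r ≠ (c.1.1 i).castSucc}) := by
  symm
  refine Equiv.ofBijective (fun y => ⟨(fun i => y.2.1.succAbove (y.1.1.1 i),
    Fin.cons y.2.1 (fun i => y.2.1.succAbove (y.1.1.2 i))), (good_insert _ _ _).2 ⟨y.1.2, y.2.2⟩⟩) ⟨?_, ?_⟩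
  · rintro ⟨⟨⟨f, g⟩, hc⟩, ⟨r, hr⟩⟩ ⟨⟨⟨f', g'⟩, hc'⟩, ⟨r', hr'⟩⟩ h
    have h := congrArg Subtype.val h
    simp only [Prod.mk.injEq, Fin.cons_inj] at h
    obtain ⟨h1, rfl, h2⟩ := h
    obtain rfl : f = f' := by
      funext i; exact Fin.succAbove_right_injective (congrFun h1 i)
    obtain rfl : g = g' := by
      funext i; exact Fin.succAbove_right_injective (congrFun h2 i)
    rfl
  · rintro ⟨⟨f, g⟩, hc⟩
    have hc0 := hc
    obtain ⟨h1, h2, h3, h4, h5⟩ := hc0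
    simp only at h1 h2 h3
    have hf : ∀ i, ∃ y, (g 0).succAbove y = f i := fun i => Fin.exists_succAbove_eq (h3 i 0)
    have hg : ∀ i : Fin b, ∃ y, (g 0).succAbove y = g i.succ :=
      fun i => Fin.exists_succAbove_eq (fun h => Fin.succ_ne_zero i (h2 h))
    choose f' hf' using hf
    choose g' hg' using hg
    have e1 : (fun i => (g 0).succAbove (f' i)) = f := funext hf'
    have e2 : (Fin.cons (g 0) (fun i => (g 0).succAbove (g' i)) : Fin (b+1) → Fin (m+1)) = g := by
      funext i; refine Fin.cases ?_ ?_ i <;> simp [hg']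
    have hc2 := hc
    simp only at hc2
    rw [← e1] at hc2
    nth_rewrite 2 [← e2] at hc2
    rw [good_insert] at hc2
    refine ⟨⟨⟨(f', g'), hc2.1⟩, ⟨g 0, hc2.2⟩⟩, ?_⟩
    apply Subtype.ext
    simp [e1, e2]

theorem card_cfg_zero (a m : ℕ) : Fintype.card (Cfg a 0 m) = m.descFactorial a := by
  have e : Cfg a 0 m ≃ (Fin a ↪ Fin m) :=
    { toFun := fun c => ⟨c.1.1, c.2.1⟩
      invFun := fun f => ⟨(f, Fin.elim0), f.injective, fun i => i.elim0, fun _ i => i.elim0,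
        fun _ i => i.elim0, fun i => i.elim0⟩
      left_inv := by
        rintro ⟨⟨f, g⟩, h⟩
        apply Subtype.ext
        refine Prod.ext rfl (Subsingleton.elim _ _)
      right_inv := by intro f; rfl }
  rw [Fintype.card_congr e, Fintype.card_embedding_eq]
  simp

theorem card_cfg_succ (a b m : ℕ) :
    Fintype.card (Cfg a (b+1) (m+1)) = Fintype.card (Cfg a b m) * (m - a) := by
  classical
  rw [Fintype.card_congr (insEquiv a b m), Fintype.card_sigma]
  rw [Finset.sum_const_nat (m := m - a)]
  · rfl
  · rintro ⟨⟨f, g⟩, h⟩ -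
    rw [Fintype.card_subtype]
    have : (Finset.univ.filter fun r : Fin (m+1) => r ≠ Fin.last m ∧ ∀ i, r ≠ (f i).castSucc)
        = ((Finset.univ.image f)ᶜ).map Fin.castSuccEmb := by
      ext r
      refine Fin.lastCases ?_ ?_ r
      · simp
      · intro r; simp [Fin.castSucc_ne_last, eq_comm]
    simp only
    rw [this, Finset.card_map, Finset.card_compl, Finset.card_image_of_injective _ h.1]
    simp

theorem card_cfg (a b m : ℕ) (h : a + b < m) : (Fintype.card (Cfg a b m) : ℚ) =
    (∏ i ∈ Finset.range b, ((m : ℚ) - 1 - a - i)) * ∏ i ∈ Finset.range a, ((m : ℚ) - b - i) := by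
  induction b generalizing m with
  | zero =>
    rw [card_cfg_zero]
    simp only [Finset.range_zero, Finset.prod_empty, one_mul, Nat.cast_zero, sub_zero]
    rw [Nat.descFactorial_eq_prod_range, Nat.cast_prod]
    apply Finset.prod_congr rfl
    intro i hi
    rw [Finset.mem_range] at hi
    rw [Nat.cast_sub (by omega)]
  | succ b ih =>
    obtain ⟨m, rfl⟩ : ∃ m', m = m' + 1 := ⟨m - 1, by omega⟩
    rw [card_cfg_succ, Nat.cast_mul, ih m (by omega), Finset.prod_range_succ', Nat.cast_sub (by omega)]
    push_cast
    have e1 : ∀ i : ℕ, (m : ℚ) + 1 - 1 - a - (i + 1) = m - 1 - a - i := by intro i; ring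
    have e2 : ∀ i : ℕ, (m : ℚ) + 1 - (b + 1) - i = m - b - i := by intro i; ring
    simp only [e1, e2]
    ring

/-- The 0/1 indicator vector of `I`. -/
def indV {N : ℕ} (I : Finset (Fin N)) : Fin N → ℤ := fun i => if i ∈ I then 1 else 0

theorem mem_solK_ind {K : Type*} [Field K] {N : ℕ} (S : Finset (Finset (Fin N))) (x : Fin N → K) :
    x ∈ solK K (Set.image indV (S : Set (Finset (Fin N)))) ↔ ∀ I ∈ S, ∑ i ∈ I, x i = 0 := by
  change (∀ v ∈ _, _) ↔ _
  simp [indV, Finset.sum_ite_mem]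

theorem linForm_apply {N : ℕ} (I : Finset (Fin N)) (x : Fin N → ℚ) : linForm I x = ∑ i ∈ I, x i := by
  simp [linForm]

theorem ker_linForm_inj {N : ℕ} {I J : Finset (Fin N)} (h : LinearMap.ker (linForm I) = LinearMap.ker (linForm J)) : I = J := by
  classical
  have h' : ∀ x : Fin N → ℚ, ∑ i ∈ I, x i = 0 ↔ ∑ i ∈ J, x i = 0 := by
    intro x
    rw [← linForm_apply, ← linForm_apply, ← LinearMap.mem_ker, h, LinearMap.mem_ker]
  have hs : ∀ i, i ∈ I ↔ i ∈ J := by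
    intro i
    have := h' (Pi.single i 1)
    simp [Finset.sum_pi_single'] at this
    tauto
  exact Finset.ext hs

theorem iInf_ker {N : ℕ} (S : Finset (Finset (Fin N))) [DecidableEq (Submodule ℚ (Fin N → ℚ))] :
    (⨅ H ∈ S.image (fun I => LinearMap.ker (linForm I)), H) =
      solK ℚ (Set.image indV (S : Set (Finset (Fin N)))) := by
  ext x
  rw [mem_solK_ind]
  simp [Submodule.mem_iInf, linForm_apply]

open Classical in
theorem charPoly_csa {N : ℕ} (G : SimpleGraph (Fin N)) :
    charPoly (csaFinset G) = ∑ S ∈ (Finset.univ.filter fun I => ConnSet G I).powerset,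
      ((-1 : ℚ) ^ S.card) • (Polynomial.X : Polynomial ℚ) ^
        (Module.finrank ℚ (solK ℚ (Set.image indV (S : Set (Finset (Fin N)))))) := by
  have hinj : Set.InjOn (fun I : Finset (Fin N) => LinearMap.ker (linForm I))
      ((Finset.univ.filter fun I => ConnSet G I : Finset (Finset (Fin N))) : Set (Finset (Fin N))) := by
    intro I hI J hJ h
    exact ker_linForm_inj h
  unfold charPoly csaFinset
  symm
  refine Finset.sum_bij (fun S _ => S.image (fun I => LinearMap.ker (linForm I))) ?_ ?_ ?_ ?_
  · intro S hS
    rw [Finset.mem_powerset] at hS ⊢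
    exact Finset.image_subset_image hS
  · intro S hS T hT h
    rw [Finset.mem_powerset] at hS hT
    have h2 := congrArg (fun U : Finset (Submodule ℚ (Fin N → ℚ)) => (U : Set (Submodule ℚ (Fin N → ℚ)))) h
    simp only [Finset.coe_image] at h2
    have := (hinj.image_eq_image_iff (by exact_mod_cast hS) (by exact_mod_cast hT)).1 h2
    exact_mod_cast this
  · intro B hB
    rw [Finset.mem_powerset] at hB
    obtain ⟨S, hS, rfl⟩ := Finset.subset_image_iff.1 hB
    exact ⟨S, by rw [Finset.mem_powerset]; exact_mod_cast hS, rfl⟩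
  · intro S hS
    rw [Finset.mem_powerset] at hS
    rw [Finset.card_image_of_injOn (hinj.mono (by exact_mod_cast hS)), iInf_ker]

theorem charPoly_eval {N : ℕ} (G : SimpleGraph (Fin N)) : ∃ D : ℕ, D ≠ 0 ∧
    ∀ p : ℕ, p.Prime → ¬ p ∣ D → (charPoly (csaFinset G)).eval (p : ℚ) =
      (Nat.card {x : Fin N → ZMod p // ∀ I, ConnSet G I → ∑ i ∈ I, x i ≠ 0} : ℚ) := by
  classical
  choose d D hD hd using fun S : Finset (Finset (Fin N)) =>
    exists_rank (Set.image indV (S : Set (Finset (Fin N))))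
  refine ⟨∏ S, D S, ?_, ?_⟩
  · simpa [Finset.prod_eq_zero_iff] using hD
  intro p hp hpD
  have := Fact.mk hp
  have h1 : ∀ S, ((D S : ℕ) : ZMod p) ≠ 0 := by
    intro S h
    rw [ZMod.natCast_eq_zero_iff] at h
    exact hpD (h.trans (Finset.dvd_prod_of_mem _ (Finset.mem_univ S)))
  rw [charPoly_csa, Polynomial.eval_finsetSum]
  have h2 : ∀ S : Finset (Finset (Fin N)),
      (p : ℚ) ^ (Module.finrank ℚ (solK ℚ (Set.image indV (S : Set (Finset (Fin N)))))) =
      ∑ x : Fin N → ZMod p, ∏ I ∈ S, if ∑ i ∈ I, x i = 0 then (1 : ℚ) else 0 := by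
    intro S
    rw [hd S ℚ (by exact_mod_cast hD S), ← hd S (ZMod p) (h1 S)]
    have := Module.card_eq_pow_finrank (K := ZMod p) (V := solK (ZMod p) (Set.image indV (S : Set (Finset (Fin N)))))
    rw [ZMod.card] at this
    rw [← Nat.cast_pow, ← this]
    simp only [Finset.prod_ite_zero, Finset.prod_const_one]
    rw [Finset.sum_boole]
    congr 1
    rw [Fintype.card_subtype]
    congr 1
    ext x
    simp [mem_solK_ind]
  simp only [Polynomial.eval_smul, Polynomial.eval_pow, Polynomial.eval_X, h2, smul_eq_mul, Finset.mul_sum]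
  rw [Finset.sum_comm]
  have h3 : ∀ x : Fin N → ZMod p, (∑ S ∈ (Finset.univ.filter fun I => ConnSet G I).powerset,
      (-1 : ℚ) ^ S.card * ∏ I ∈ S, (if ∑ i ∈ I, x i = 0 then (1 : ℚ) else 0)) =
      if ∀ I, ConnSet G I → ∑ i ∈ I, x i ≠ 0 then 1 else 0 := by
    intro x
    have := Finset.prod_add (fun I : Finset (Fin N) => -(if ∑ i ∈ I, x i = 0 then (1 : ℚ) else 0))
      (fun _ => 1) (Finset.univ.filter fun I => ConnSet G I)
    simp only [Finset.prod_const_one, mul_one, Finset.prod_neg] at this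
    rw [← this]
    have h4 : ∀ I : Finset (Fin N), -(if ∑ i ∈ I, x i = 0 then (1 : ℚ) else 0) + 1 =
      if ∑ i ∈ I, x i ≠ 0 then 1 else 0 := by
      intro I; split_ifs <;> simp_all
    simp only [h4, Finset.prod_ite_zero, Finset.prod_const_one]
    simp
  simp only [h3]
  rw [Finset.sum_boole, Nat.card_eq_fintype_card, Fintype.card_subtype]

section conn
variable {n k : ℕ}

theorem almostPath_adj (a b : Fin (n+1)) : (almostPath n k).Adj a b ↔ a.val ≠ b.val ∧
    (((a.val + 1 = b.val ∧ b.val < n) ∨ (a.val = k - 1 ∧ b.val = n)) ∨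
     ((b.val + 1 = a.val ∧ a.val < n) ∨ (b.val = k - 1 ∧ a.val = n))) := by
  simp [almostPath, SimpleGraph.fromRel_adj, Fin.ext_iff]

theorem connSet_invariant {N : ℕ} {G : SimpleGraph (Fin N)} {I : Finset (Fin N)} (h : ConnSet G I)
    (P : Fin N → Prop) (hP : ∀ a ∈ I, ∀ b ∈ I, G.Adj a b → P a → P b)
    {u v : Fin N} (hu : u ∈ I) (hv : v ∈ I) (hPu : P u) : P v := by
  obtain ⟨w⟩ := h.2.preconnected ⟨u, hu⟩ ⟨v, hv⟩
  have : ∀ (a b : (↑I : Set (Fin N))) (w : (G.induce (↑I : Set (Fin N))).Walk a b), P a → P b := by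
    intro a b w
    induction w with
    | nil => exact id
    | @cons a b c hab _ ih =>
      intro ha
      exact ih (hP a.1 a.2 b.1 b.2 hab ha)
  exact this _ _ w hPu

/-- The set of vertices of the path in the half-open interval `[i, j)`. -/
def ivl (n i j : ℕ) : Finset (Fin (n+1)) := Finset.univ.filter fun v => i ≤ v.val ∧ v.val < j

theorem mem_ivl {i j : ℕ} {v : Fin (n+1)} : v ∈ ivl n i j ↔ i ≤ v.val ∧ v.val < j := by
  simp [ivl]

theorem connSet_singleton {N : ℕ} (G : SimpleGraph (Fin N)) (v : Fin N) : ConnSet G {v} := by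
  refine ⟨by simp, ?_⟩
  rw [SimpleGraph.connected_iff_exists_forall_reachable]
  refine ⟨⟨v, by simp⟩, ?_⟩
  rintro ⟨w, hw⟩
  have : w = v := by simpa using hw
  subst this
  rfl

theorem ivl_reach (I : Finset (Fin (n+1))) {i j : ℕ} (hij : i < j) (hj : j ≤ n) (hI : ivl n i j ⊆ I)
    (h0 : (⟨i, by omega⟩ : Fin (n+1)) ∈ I) (d : ℕ) (hd : i + d < j)
    (h1 : (⟨i + d, by omega⟩ : Fin (n+1)) ∈ I) :
    ((almostPath n k).induce (↑I : Set (Fin (n+1)))).Reachable ⟨⟨i, by omega⟩, h0⟩ ⟨⟨i + d, by omega⟩, h1⟩ := by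
  induction d with
  | zero => rfl
  | succ d ih =>
    have h2 : (⟨i + d, by omega⟩ : Fin (n+1)) ∈ I := hI (by rw [mem_ivl]; simp; omega)
    refine (ih (by omega) h2).trans (SimpleGraph.Adj.reachable ?_)
    simp only [SimpleGraph.comap_adj, Function.Embedding.subtype_apply, almostPath_adj]
    omega

theorem connSet_ivl {i j : ℕ} (hij : i < j) (hj : j ≤ n) : ConnSet (almostPath n k) (ivl n i j) := by
  have h0 : (⟨i, by omega⟩ : Fin (n+1)) ∈ ivl n i j := by rw [mem_ivl]; simp; omega
  refine ⟨⟨_, h0⟩, ?_⟩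
  rw [SimpleGraph.connected_iff_exists_forall_reachable]
  refine ⟨⟨_, h0⟩, ?_⟩
  rintro ⟨⟨w, hw'⟩, hw⟩
  have hw2 := hw
  rw [Finset.mem_coe, mem_ivl] at hw2
  simp only at hw2
  obtain ⟨d, rfl⟩ := Nat.exists_eq_add_of_le hw2.1
  exact ivl_reach _ hij hj subset_rfl h0 d hw2.2 hw

theorem connSet_ivl_insert {i j : ℕ} (hk : 1 < k) (hij : i < k) (hkj : k ≤ j) (hj : j ≤ n) :
    ConnSet (almostPath n k) (insert (Fin.last n) (ivl n i j)) := by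
  have h0 : (⟨i, by omega⟩ : Fin (n+1)) ∈ insert (Fin.last n) (ivl n i j) := by
    rw [Finset.mem_insert, mem_ivl]; simp; omega
  refine ⟨⟨_, h0⟩, ?_⟩
  rw [SimpleGraph.connected_iff_exists_forall_reachable]
  refine ⟨⟨_, h0⟩, ?_⟩
  rintro ⟨w, hw⟩
  have hw2 := hw
  rw [Finset.mem_coe, Finset.mem_insert, mem_ivl] at hw2
  rcases hw2 with rfl | hw2
  · obtain ⟨d, hd⟩ := Nat.exists_eq_add_of_le (show i ≤ k - 1 by omega)
    have h1 : (⟨i + d, by omega⟩ : Fin (n+1)) ∈ insert (Fin.last n) (ivl n i j) := by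
      rw [Finset.mem_insert, mem_ivl]; simp; omega
    refine (ivl_reach _ (by omega) hj (Finset.subset_insert _ _) h0 d (by omega) h1).trans
      (SimpleGraph.Adj.reachable ?_)
    change (almostPath n k).Adj ⟨i + d, by omega⟩ (Fin.last n)
    rw [almostPath_adj]
    refine ⟨?_, Or.inl (Or.inr ⟨?_, Fin.val_last n⟩)⟩
    · rw [Fin.val_last]
      change i + d ≠ n
      omega
    · exact hd.symm
  · obtain ⟨w, hw'⟩ := w
    simp only at hw2
    obtain ⟨d, rfl⟩ := Nat.exists_eq_add_of_le hw2.1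
    exact ivl_reach _ (by omega) hj (Finset.subset_insert _ _) h0 d hw2.2 hw

theorem connSet_cases (hk : 1 < k) (hkn : k < n) {I : Finset (Fin (n+1))} (h : ConnSet (almostPath n k) I) :
    I = {Fin.last n} ∨ (∃ i j, i < j ∧ j ≤ n ∧ I = ivl n i j) ∨
      ∃ i j, i < k ∧ k ≤ j ∧ j ≤ n ∧ I = insert (Fin.last n) (ivl n i j) := by
  classical
  let J := I.erase (Fin.last n)
  have hJ : ∀ v, v ∈ J ↔ v ∈ I ∧ v.val < n := by
    intro v
    have := v.2
    simp only [J, Finset.mem_erase, ne_eq, Fin.ext_iff, Fin.val_last]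
    constructor
    · rintro ⟨h1, h2⟩; exact ⟨h2, by omega⟩
    · rintro ⟨h1, h2⟩; exact ⟨by omega, h1⟩
  by_cases hJe : J.Nonempty
  swap
  · left
    rw [Finset.not_nonempty_iff_eq_empty, Finset.erase_eq_empty_iff] at hJe
    rcases hJe with hJe | hJe
    · exact absurd h.1 (by simp [hJe])
    · exact hJe
  right
  have hconv : ∀ u ∈ J, ∀ v ∈ J, ∀ w : Fin (n+1), u.val < w.val → w.val < v.val → w ∈ J := by
    intro u hu v hv w huw hwv
    rw [hJ] at hu hv ⊢
    by_contra hw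
    have hw' : w ∉ I := fun hh => hw ⟨hh, by omega⟩
    have := connSet_invariant h (fun a => a.val < w.val ∨ (a.val = n ∧ k - 1 < w.val)) ?_ hu.1 hv.1
      (Or.inl huw)
    · omega
    · intro a ha b hb hab
      rw [almostPath_adj] at hab
      have ha' : a.val ≠ w.val := fun hh => hw' (Fin.ext hh ▸ ha)
      have hb' : b.val ≠ w.val := fun hh => hw' (Fin.ext hh ▸ hb)
      omega
  have hJI : J = ivl n (J.min' hJe).val ((J.max' hJe).val + 1) := by
    ext v
    rw [mem_ivl]
    constructor
    · intro hv
      have h1 := Fin.le_def.1 (J.min'_le v hv)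
      have h2 := Fin.le_def.1 (J.le_max' v hv)
      omega
    · rintro ⟨h1, h2⟩
      have m1 := J.min'_mem hJe
      have m2 := J.max'_mem hJe
      by_cases e1 : (J.min' hJe).val = v.val
      · rwa [Fin.ext e1] at m1
      by_cases e2 : (J.max' hJe).val = v.val
      · rwa [Fin.ext e2] at m2
      exact hconv _ m1 _ m2 v (by omega) (by omega)
  have hmax := ((hJ _).1 (J.max'_mem hJe)).2
  have hmm := Fin.le_def.1 (J.min'_le _ (J.max'_mem hJe))
  by_cases hl : Fin.last n ∈ I
  · right
    have hk1 : (⟨k - 1, by omega⟩ : Fin (n+1)) ∈ J := by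
      rw [hJ]
      refine ⟨?_, by simp; omega⟩
      by_contra hk1
      have := connSet_invariant h (fun a => a.val = n) ?_ hl ((hJ _).1 (J.max'_mem hJe)).1 rfl
      · omega
      · intro a ha b hb hab
        rw [almostPath_adj] at hab
        have hb' : b.val ≠ k - 1 := fun hh => hk1 (by
          have : b = ⟨k - 1, by omega⟩ := Fin.ext hh
          rwa [this] at hb)
        omega
    have hk2 := hk1
    rw [hJI, mem_ivl] at hk2
    simp only at hk2
    refine ⟨(J.min' hJe).val, (J.max' hJe).val + 1, ?_, ?_, ?_, ?_⟩
    rotate_left 3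
    · rw [← hJI, Finset.insert_erase hl]
    all_goals omega
  · left
    refine ⟨(J.min' hJe).val, (J.max' hJe).val + 1, ?_, ?_, ?_⟩
    rotate_left 2
    · rw [← hJI]; exact (Finset.erase_eq_of_notMem hl).symm
    all_goals omega

/-- partial sums -/
def psum {K : Type*} [Field K] (x : Fin (n+1) → K) (j : ℕ) : K := ∑ v ∈ ivl n 0 j, x v

theorem sum_ivl {K : Type*} [Field K] (x : Fin (n+1) → K) {i j : ℕ} (h : i ≤ j) :
    ∑ v ∈ ivl n i j, x v = psum x j - psum x i := by
  rw [eq_sub_iff_add_eq, psum, psum, ← Finset.sum_union]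
  · congr 1
    ext v
    simp only [Finset.mem_union, mem_ivl]
    omega
  · rw [Finset.disjoint_left]
    intro v
    simp only [mem_ivl]
    omega

theorem last_notMem_ivl {i j : ℕ} (h : j ≤ n) : Fin.last n ∉ ivl n i j := by
  rw [mem_ivl]; simp; omega

theorem compl_iff {K : Type*} [Field K] (hk : 1 < k) (hkn : k < n) (x : Fin (n+1) → K) :
    (∀ I, ConnSet (almostPath n k) I → ∑ i ∈ I, x i ≠ 0) ↔
      x (Fin.last n) ≠ 0 ∧ (∀ i j, i < j → j ≤ n → psum x i ≠ psum x j) ∧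
      ∀ i j, i < k → k ≤ j → j ≤ n → psum x i ≠ psum x j + x (Fin.last n) := by
  constructor
  · intro h
    refine ⟨?_, ?_, ?_⟩
    · simpa using h _ (connSet_singleton _ (Fin.last n))
    · intro i j hij hj e
      apply h _ (connSet_ivl hij hj)
      rw [sum_ivl x hij.le, e, sub_self]
    · intro i j hik hkj hj e
      apply h _ (connSet_ivl_insert hk hik hkj hj)
      rw [Finset.sum_insert (last_notMem_ivl hj), sum_ivl x (by omega), e]
      ring
  · rintro ⟨h1, h2, h3⟩ I hI
    rcases connSet_cases hk hkn hI with rfl | ⟨i, j, hij, hj, rfl⟩ | ⟨i, j, hik, hkj, hj, rfl⟩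
    · simpa using h1
    · rw [sum_ivl x hij.le, sub_ne_zero]
      exact (h2 i j hij hj).symm
    · rw [Finset.sum_insert (last_notMem_ivl hj), sum_ivl x (by omega)]
      intro e
      apply h3 i j hik hkj hj
      linear_combination -e
end conn

section bij
variable {a b m : ℕ}

/-- The positions, as natural numbers, of the points of a configuration. -/
def tau (f : Fin a → Fin m) (g : Fin b → Fin m) (j : ℕ) : ℕ :=
  if j = 0 then 0 else if h : j - 1 < a then (f ⟨j - 1, h⟩).val + 1
    else if h : j - 1 - a < b then (g ⟨j - 1 - a, h⟩).val + 1 else 0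

theorem tau_zero (f : Fin a → Fin m) (g : Fin b → Fin m) : tau f g 0 = 0 := by simp [tau]

theorem tau_f (f : Fin a → Fin m) (g : Fin b → Fin m) (i : Fin a) :
    tau f g (i.val + 1) = (f i).val + 1 := by
  simp [tau]

theorem tau_g (f : Fin a → Fin m) (g : Fin b → Fin m) (i : Fin b) :
    tau f g (a + 1 + i.val) = (g i).val + 1 := by
  have h1 : ¬ (a + 1 + i.val - 1 < a) := by omega
  have h2 : a + 1 + i.val - 1 - a = i.val := by omega
  have h3 : a + 1 + i.val ≠ 0 := by omega
  rw [tau, if_neg h3, dif_neg h1, dif_pos (by omega)]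
  simp only [h2]

theorem idx_left {i : ℕ} (h : i < a + 1) : i = 0 ∨ ∃ j : Fin a, i = j.val + 1 := by
  rcases Nat.eq_zero_or_pos i with h0 | h0
  · exact Or.inl h0
  · exact Or.inr ⟨⟨i - 1, by omega⟩, by simp; omega⟩

theorem idx_right {i : ℕ} (h : a + 1 ≤ i) (h' : i ≤ a + b) : ∃ j : Fin b, i = a + 1 + j.val :=
  ⟨⟨i - (a + 1), by omega⟩, by simp; omega⟩

theorem tau_lt (f : Fin a → Fin m) (g : Fin b → Fin m) (j : ℕ) : tau f g j < m + 1 := by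
  unfold tau
  split_ifs <;> omega

theorem good_iff_tau (f : Fin a → Fin m) (g : Fin b → Fin m) : Good f g ↔
    (∀ i j, i < j → j ≤ a + b → tau f g i ≠ tau f g j) ∧
    ∀ i j, i < a + 1 → a + 1 ≤ j → j ≤ a + b →
      tau f g i ≠ tau f g j + 1 ∧ ¬ (tau f g i = 0 ∧ tau f g j = m) := by
  constructor
  · rintro ⟨h1, h2, h3, h4, h5⟩
    refine ⟨?_, ?_⟩
    · intro i j hij hj
      by_cases hi' : i < a + 1
      · by_cases hj' : j < a + 1
        · obtain ⟨j, rfl⟩ := (idx_left hj').resolve_left (by omega)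
          rcases idx_left hi' with rfl | ⟨i, rfl⟩
          · rw [tau_zero, tau_f]; omega
          · rw [tau_f, tau_f]
            intro h
            have := h1 (Fin.ext (by omega) : f i = f j)
            subst this; omega
        · obtain ⟨j, rfl⟩ := idx_right (by omega) hj
          rcases idx_left hi' with rfl | ⟨i, rfl⟩
          · rw [tau_zero, tau_g]; omega
          · rw [tau_f, tau_g]
            intro h
            exact h3 i j (Fin.ext (by omega))
      · obtain ⟨i, rfl⟩ := idx_right (show a + 1 ≤ i by omega) (show i ≤ a + b by omega)
        obtain ⟨j, rfl⟩ := idx_right (show a + 1 ≤ j by omega) hj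
        rw [tau_g, tau_g]
        intro h
        have := h2 (Fin.ext (by omega) : g i = g j)
        subst this; omega
    · intro i j hi hj hj'
      obtain ⟨j, rfl⟩ := idx_right hj hj'
      have := h5 j
      rcases idx_left hi with rfl | ⟨i, rfl⟩
      · rw [tau_zero, tau_g]; omega
      · have := h4 i j
        rw [tau_f, tau_g]; omega
  · rintro ⟨h1, h2⟩
    refine ⟨?_, ?_, ?_, ?_, ?_⟩
    · intro i j h
      by_contra hne
      have hne : i.val ≠ j.val := fun hh => hne (Fin.ext hh)
      rcases Nat.lt_or_gt_of_ne hne with hl | hl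
      · apply h1 (i.val + 1) (j.val + 1) (by omega) (by omega); rw [tau_f, tau_f, h]
      · apply h1 (j.val + 1) (i.val + 1) (by omega) (by omega); rw [tau_f, tau_f, h]
    · intro i j h
      by_contra hne
      have hne : i.val ≠ j.val := fun hh => hne (Fin.ext hh)
      rcases Nat.lt_or_gt_of_ne hne with hl | hl
      · apply h1 (a + 1 + i.val) (a + 1 + j.val) (by omega) (by omega); rw [tau_g, tau_g, h]
      · apply h1 (a + 1 + j.val) (a + 1 + i.val) (by omega) (by omega); rw [tau_g, tau_g, h]
    · intro i j h
      apply h1 (i.val + 1) (a + 1 + j.val) (by omega) (by omega); rw [tau_f, tau_g, h]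
    · intro i j h
      apply (h2 (i.val + 1) (a + 1 + j.val) (by omega) (by omega) (by omega)).1; rw [tau_f, tau_g, h]
    · intro j h
      apply (h2 0 (a + 1 + j.val) (by omega) (by omega) (by omega)).2; rw [tau_zero, tau_g]
      exact ⟨rfl, h⟩

theorem cast_eq_iff {x y : ℕ} (hx : x < m + 1) (hy : y < m + 1) :
    (x : ZMod (m+1)) = (y : ZMod (m+1)) ↔ x = y := by
  rw [ZMod.natCast_eq_natCast_iff', Nat.mod_eq_of_lt hx, Nat.mod_eq_of_lt hy]

theorem cast_eq_succ_iff {x y : ℕ} (hx : x < m + 1) (hy : y < m + 1) :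
    (x : ZMod (m+1)) = (y : ZMod (m+1)) + 1 ↔ x = y + 1 ∨ (x = 0 ∧ y = m) := by
  rcases Nat.lt_or_ge (y + 1) (m + 1) with h | h
  · have := cast_eq_iff (m := m) hx h
    push_cast at this
    rw [this]; omega
  · have hy' : y = m := by omega
    subst hy'
    have h0 : ((y : ZMod (y+1)) + 1) = ((0 : ℕ) : ZMod (y+1)) := by
      have := ZMod.natCast_self (y+1)
      push_cast at this ⊢
      exact this
    rw [h0, cast_eq_iff hx (by omega)]
    omega

theorem good_iff_cast (f : Fin a → Fin m) (g : Fin b → Fin m) : Good f g ↔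
    (∀ i j, i < j → j ≤ a + b → (tau f g i : ZMod (m+1)) ≠ tau f g j) ∧
    ∀ i j, i < a + 1 → a + 1 ≤ j → j ≤ a + b →
      (tau f g i : ZMod (m+1)) ≠ tau f g j + 1 := by
  rw [good_iff_tau]
  simp only [ne_eq, cast_eq_iff (tau_lt f g _) (tau_lt f g _), cast_eq_succ_iff (tau_lt f g _) (tau_lt f g _), not_or]

/-- The point of the complement attached to a scalar and a configuration. -/
def pt (a b m : ℕ) (z : ZMod (m+1)) (f : Fin a → Fin m) (g : Fin b → Fin m) : Fin (a + b + 1) → ZMod (m+1) :=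
  fun v => if v.val < a + b then z * ((tau f g (v.val + 1) : ZMod (m+1)) - tau f g v.val) else z

theorem psum_zero {K : Type*} [Field K] {n : ℕ} (x : Fin (n+1) → K) : psum x 0 = 0 := by
  have : ivl n 0 0 = ∅ := by ext v; simp [mem_ivl]
  simp [psum, this]

theorem psum_succ {K : Type*} [Field K] {n : ℕ} (x : Fin (n+1) → K) (v : Fin (n+1)) :
    psum x (v.val + 1) = psum x v.val + x v := by
  have h := sum_ivl x (i := v.val) (j := v.val + 1) (by omega)
  have : ivl n v.val (v.val + 1) = {v} := by
    ext w; rw [mem_ivl, Finset.mem_singleton, Fin.ext_iff]; omega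
  rw [this, Finset.sum_singleton] at h
  rw [h]; ring

variable [Fact (m+1).Prime]

theorem psum_pt (z : ZMod (m+1)) (f : Fin a → Fin m) (g : Fin b → Fin m) (j : ℕ) (hj : j ≤ a + b) :
    psum (pt a b m z f g) j = z * tau f g j := by
  induction j with
  | zero => simp [psum_zero, tau_zero]
  | succ j ih =>
    have := psum_succ (pt a b m z f g) ⟨j, by omega⟩
    simp only at this
    rw [this, ih (by omega), pt, if_pos (show j < a + b by omega)]
    ring

theorem pt_last (z : ZMod (m+1)) (f : Fin a → Fin m) (g : Fin b → Fin m) :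
    pt a b m z f g (Fin.last _) = z := by simp [pt]

/-- The complement condition in terms of partial sums. -/
def Cpl (a b m : ℕ) [Fact (m+1).Prime] (x : Fin (a + b + 1) → ZMod (m+1)) : Prop :=
  x (Fin.last _) ≠ 0 ∧ (∀ i j, i < j → j ≤ a + b → psum x i ≠ psum x j) ∧
      ∀ i j, i < a + 1 → a + 1 ≤ j → j ≤ a + b → psum x i ≠ psum x j + x (Fin.last _)

theorem cpl_pt (z : ZMod (m+1)) (hz : z ≠ 0) (f : Fin a → Fin m) (g : Fin b → Fin m) :
    Cpl a b m (pt a b m z f g) ↔ Good f g := by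
  rw [good_iff_cast, Cpl, pt_last]
  refine ⟨fun ⟨_, h1, h2⟩ => ⟨?_, ?_⟩, fun ⟨h1, h2⟩ => ⟨hz, ?_, ?_⟩⟩
  · intro i j hij hj e
    apply h1 i j hij hj
    rw [psum_pt _ _ _ _ (by omega), psum_pt _ _ _ _ (by omega), e]
  · intro i j hi hj hj' e
    apply h2 i j hi hj hj'
    rw [psum_pt _ _ _ _ (by omega), psum_pt _ _ _ _ (by omega), e]; ring
  · intro i j hij hj e
    apply h1 i j hij hj
    rw [psum_pt _ _ _ _ (by omega), psum_pt _ _ _ _ (by omega)] at e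
    exact mul_left_cancel₀ hz e
  · intro i j hi hj hj' e
    apply h2 i j hi hj hj'
    rw [psum_pt _ _ _ _ (by omega), psum_pt _ _ _ _ (by omega)] at e
    apply mul_left_cancel₀ hz
    rw [e]; ring

theorem card_cpl : Nat.card {x : Fin (a + b + 1) → ZMod (m+1) // Cpl a b m x} =
    m * Fintype.card (Cfg a b m) := by
  have hz : Nat.card {z : ZMod (m+1) // z ≠ 0} = m := by
    rw [Nat.card_eq_fintype_card, Fintype.card_subtype_compl, ZMod.card]; simp
  have e0 : m * Fintype.card (Cfg a b m) = Nat.card ({z : ZMod (m+1) // z ≠ 0} × Cfg a b m) := by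
    rw [Nat.card_prod, hz, Nat.card_eq_fintype_card]
  rw [e0]
  symm
  let F : {z : ZMod (m+1) // z ≠ 0} × Cfg a b m → {x : Fin (a + b + 1) → ZMod (m+1) // Cpl a b m x} :=
    fun y => ⟨pt a b m y.1.1 y.2.1.1 y.2.1.2, (cpl_pt _ y.1.2 _ _).2 y.2.2⟩
  refine Nat.card_eq_of_bijective F ⟨?_, ?_⟩
  · rintro ⟨⟨z, hz⟩, ⟨⟨f, g⟩, hc⟩⟩ ⟨⟨z', hz'⟩, ⟨⟨f', g'⟩, hc'⟩⟩ h
    have h := congrArg Subtype.val h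
    simp only [F] at h
    obtain rfl : z = z' := by
      have := congrFun h (Fin.last _)
      rwa [pt_last, pt_last] at this
    have ht : ∀ j, j ≤ a + b → tau f g j = tau f' g' j := by
      intro j hj
      have e := psum_pt z f g j hj
      rw [h, psum_pt _ _ _ j hj] at e
      exact ((cast_eq_iff (tau_lt _ _ _) (tau_lt _ _ _)).1 (mul_left_cancel₀ hz e)).symm
    obtain rfl : f = f' := by
      funext i
      have := ht (i.val + 1) (by omega)
      rw [tau_f, tau_f] at this
      exact Fin.ext (by omega)
    obtain rfl : g = g' := by
      funext i
      have := ht (a + 1 + i.val) (by omega)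
      rw [tau_g, tau_g] at this
      exact Fin.ext (by omega)
    rfl
  · rintro ⟨x, hx⟩
    let z := x (Fin.last _)
    have hz : z ≠ 0 := hx.1
    let t : ℕ → ℕ := fun j => (psum x j / z).val
    have ht1 : ∀ j, t j < m + 1 := fun j => ZMod.val_lt _
    have ht0 : ∀ j, 0 < j → j ≤ a + b → t j ≠ 0 := by
      intro j h0 hj e
      apply hx.2.1 0 j h0 hj
      rw [ZMod.val_eq_zero, div_eq_zero_iff] at e
      rw [psum_zero, e.resolve_right hz]
    let f : Fin a → Fin m := fun i => ⟨t (i.val + 1) - 1, by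
      have := ht1 (i.val + 1); have := ht0 (i.val + 1) (by omega) (by omega); omega⟩
    let g : Fin b → Fin m := fun i => ⟨t (a + 1 + i.val) - 1, by
      have := ht1 (a + 1 + i.val); have := ht0 (a + 1 + i.val) (by omega) (by omega); omega⟩
    have htau : ∀ j, j ≤ a + b → tau f g j = t j := by
      intro j hj
      by_cases h : j < a + 1
      · rcases idx_left h with rfl | ⟨i, rfl⟩
        · simp [tau_zero, t, psum_zero]
        · have := ht0 (i.val + 1) (by omega) (by omega)
          rw [tau_f]; simp only [f]; omega
      · obtain ⟨i, rfl⟩ := idx_right (by omega) hj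
        have := ht0 (a + 1 + i.val) (by omega) (by omega)
        rw [tau_g]; simp only [g]; omega
    have htz : ∀ j, j ≤ a + b → z * (tau f g j : ZMod (m+1)) = psum x j := by
      intro j hj
      rw [htau j hj]
      simp only [t, ZMod.natCast_val, ZMod.cast_id', id_eq]
      field_simp
    have hpt : pt a b m z f g = x := by
      funext v
      unfold pt
      split_ifs with hv
      · rw [mul_sub, htz _ (by omega), htz _ (by omega), psum_succ]; ring
      · have : v = Fin.last _ := by
          apply Fin.ext; rw [Fin.val_last]; omega
        rw [this]
    refine ⟨⟨⟨z, hz⟩, ⟨(f, g), (cpl_pt z hz f g).1 (by rw [hpt]; exact hx)⟩⟩, Subtype.ext hpt⟩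

end bij

/-- For `1 < k < n`, the characteristic polynomial of the connected
subgraph arrangement of the almost path graph `A_{n,k}` is
`(t − 1) · ∏_{i=k+1}^{n+1} (t − i) · ∏_{i=n−k+2}^{n} (t − i)`. -/
theorem csa_almostPath_charPoly (n k : ℕ) (h1 : 1 < k) (h2 : k < n) :
    charPoly (csaFinset (almostPath n k)) =
      (Polynomial.X - 1) *
        (∏ i ∈ Finset.Icc (k + 1) (n + 1), (Polynomial.X - Polynomial.C (i : ℚ))) *
        (∏ i ∈ Finset.Icc (n - k + 2) n, (Polynomial.X - Polynomial.C (i : ℚ))) := by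
  obtain ⟨D, hD, hev⟩ := charPoly_eval (almostPath n k)
  refine Polynomial.eq_of_infinite_eval_eq _ _ ?_
  have hinf : {p : ℕ | p.Prime ∧ D < p ∧ n + 2 < p}.Infinite := by
    rw [Set.infinite_iff_exists_gt]
    intro q
    obtain ⟨p, hp1, hp2⟩ := Nat.exists_infinite_primes (q + D + n + 3)
    exact ⟨p, ⟨hp2, by omega, by omega⟩, by omega⟩
  refine (hinf.image (f := fun p : ℕ => (p : ℚ)) (Nat.cast_injective.injOn)).mono ?_
  rintro _ ⟨p, ⟨hp, hpD, hpn⟩, rfl⟩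
  simp only [Set.mem_ofPred_eq]
  rw [hev p hp (fun h => by have := Nat.le_of_dvd (Nat.pos_of_ne_zero hD) h; omega)]
  obtain ⟨m, rfl⟩ : ∃ m, p = m + 1 := ⟨p - 1, by omega⟩
  have : Fact (m+1).Prime := ⟨hp⟩
  obtain ⟨a, rfl⟩ : ∃ a, k = a + 1 := ⟨k - 1, by omega⟩
  obtain ⟨b, rfl⟩ : ∃ b, n = a + b := ⟨n - a, by omega⟩
  have e1 : Nat.card {x : Fin (a + b + 1) → ZMod (m+1) // ∀ I, ConnSet (almostPath (a + b) (a + 1)) I → ∑ i ∈ I, x i ≠ 0}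
      = Nat.card {x : Fin (a + b + 1) → ZMod (m+1) // Cpl a b m x} :=
    Nat.card_congr (Equiv.subtypeEquivRight fun x => compl_iff h1 h2 x)
  rw [e1, card_cpl, Nat.cast_mul, card_cfg a b m (by omega)]
  simp only [Polynomial.eval_mul, Polynomial.eval_prod, Polynomial.eval_sub, Polynomial.eval_X,
    Polynomial.eval_C, Polynomial.eval_one]
  have p1 : ∏ i ∈ Finset.Icc (a + 1 + 1) (a + b + 1), (((m + 1 : ℕ) : ℚ) - (i : ℚ)) =
      ∏ i ∈ Finset.range b, ((m : ℚ) - 1 - a - i) := by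
    rw [← Finset.Ico_add_one_right_eq_Icc, Finset.prod_Ico_eq_prod_range]
    rw [show a + b + 1 + 1 - (a + 1 + 1) = b by omega]
    apply Finset.prod_congr rfl
    intro i _
    push_cast; ring
  have p2 : ∏ i ∈ Finset.Icc (a + b - (a + 1) + 2) (a + b), (((m + 1 : ℕ) : ℚ) - (i : ℚ)) =
      ∏ i ∈ Finset.range a, ((m : ℚ) - b - i) := by
    rw [← Finset.Ico_add_one_right_eq_Icc, Finset.prod_Ico_eq_prod_range]
    rw [show a + b - (a + 1) + 2 = b + 1 by omega, show a + b + 1 - (b + 1) = a by omega]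
    apply Finset.prod_congr rfl
    intro i _
    push_cast; ring
  rw [p1, p2]
  push_cast
  ring
end

section
/- Let 1 < k < n and let Δ_{n,k} be the path-with-triangle graph on vertices [n+1]. Then the connected subgraph arrangement 𝒜_{Δ_{n,k}} over ℚ is free, i.e. its module of 𝒜_{Δ_{n,k}}-derivations is a free module over ℚ[x_1,…,x_{n+1}]. -/
open Finset

section Anti
variable {R : Type*} [CommRing R] [Algebra ℚ R]

/-- Antidifference of `x ^ m` with step `t` (homogenized Bernoulli polynomial). -/
noncomputable def antiE (t x : R) (m : ℕ) : R :=
  ((m + 1 : ℚ)⁻¹) • (x ^ (m + 1) -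
    ∑ i : Fin m, ((m + 1).choose i : R) * t ^ (m - i) * antiE t x i)
termination_by m
decreasing_by exact i.2

theorem antiE_eq (t x : R) (m : ℕ) : ((m : R) + 1) * antiE t x m = x ^ (m + 1) -
    ∑ i ∈ Finset.range m, ((m + 1).choose i : R) * t ^ (m - i) * antiE t x i := by
  rw [antiE, Finset.sum_range (fun i => ((m + 1).choose i : R) * t ^ (m - i) * antiE t x i)]
  have h : ((m : R) + 1) = algebraMap ℚ R (m + 1) := by simp
  rw [h, ← Algebra.smul_def, smul_smul, mul_inv_cancel₀ (by positivity), one_smul]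

theorem nat_cancel {a b : R} (m : ℕ) (h : ((m : R) + 1) * a = ((m : R) + 1) * b) : a = b := by
  have h1 : ((m : R) + 1) = algebraMap ℚ R (m + 1) := by simp
  rw [h1, ← Algebra.smul_def, ← Algebra.smul_def] at h
  have := congrArg (fun z => ((m + 1 : ℚ)⁻¹) • z) h
  simpa [smul_smul, inv_mul_cancel₀ (by positivity : (m + 1 : ℚ) ≠ 0)] using this

theorem antiE_add (t x : R) (m : ℕ) : antiE t (x + t) m - antiE t x m = t * x ^ m := by
  induction m using Nat.strong_induction_on with
  | _ m ih =>
  apply nat_cancel m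
  rw [mul_sub, antiE_eq, antiE_eq]
  have h1 : ∑ i ∈ Finset.range m, ((m + 1).choose i : R) * t ^ (m - i) * antiE t (x + t) i
      - ∑ i ∈ Finset.range m, ((m + 1).choose i : R) * t ^ (m - i) * antiE t x i
      = ∑ i ∈ Finset.range m, ((m + 1).choose i : R) * t ^ (m + 1 - i) * x ^ i := by
    rw [← Finset.sum_sub_distrib]
    refine Finset.sum_congr rfl fun i hi => ?_
    have hi := Finset.mem_range.1 hi
    rw [← mul_sub, ih i hi, show m + 1 - i = (m - i) + 1 by omega, pow_succ]
    ring
  have h2 : (x + t) ^ (m + 1) = x ^ (m + 1) + ((m : R) + 1) * (t * x ^ m) +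
      ∑ i ∈ Finset.range m, ((m + 1).choose i : R) * t ^ (m + 1 - i) * x ^ i := by
    rw [add_pow, Finset.sum_range_succ, Finset.sum_range_succ]
    have : ∑ i ∈ Finset.range m, x ^ i * t ^ (m + 1 - i) * ((m + 1).choose i : R) =
      ∑ i ∈ Finset.range m, ((m + 1).choose i : R) * t ^ (m + 1 - i) * x ^ i :=
      Finset.sum_congr rfl fun i _ => by ring
    rw [this]
    simp
    ring
  linear_combination h2 - h1

theorem antiE_dvd (t x y : R) (m : ℕ) : (x - y) ∣ antiE t x m - antiE t y m := by
  induction m using Nat.strong_induction_on with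
  | _ m ih =>
  have h1 : (x - y) ∣ ((m : R) + 1) * (antiE t x m - antiE t y m) := by
    rw [mul_sub, antiE_eq, antiE_eq, sub_sub_sub_comm, ← Finset.sum_sub_distrib]
    refine dvd_sub (sub_dvd_pow_sub_pow _ _ _) (Finset.dvd_sum fun i hi => ?_)
    rw [← mul_sub]
    exact (ih i (Finset.mem_range.1 hi)).mul_left _
  obtain ⟨c, hc⟩ := h1
  refine ⟨((m + 1 : ℚ)⁻¹) • c, nat_cancel m ?_⟩
  have h : ((m : R) + 1) = algebraMap ℚ R (m + 1) := by simp
  rw [hc, mul_smul_comm, mul_smul_comm, h, ← Algebra.smul_def, smul_smul,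
    inv_mul_cancel₀ (by positivity), one_smul]

theorem antiE_map {R' : Type*} [CommRing R'] [Algebra ℚ R'] (φ : R →+* R') (t x : R) (m : ℕ) :
    φ (antiE t x m) = antiE (φ t) (φ x) m := by
  induction m using Nat.strong_induction_on with
  | _ m ih =>
  apply nat_cancel m
  rw [antiE_eq]
  have := congrArg φ (antiE_eq t x m)
  simp only [map_mul, map_add, map_natCast, map_one, map_sub, map_pow, map_sum] at this
  rw [this]
  congr 1
  refine Finset.sum_congr rfl fun i hi => ?_
  rw [ih i (Finset.mem_range.1 hi)]

theorem antiE_zero_step (x : R) (m : ℕ) : ((m : R) + 1) * antiE 0 x m = x ^ (m + 1) := by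
  rw [antiE_eq, Finset.sum_eq_zero, sub_zero]
  intro i hi
  have hi := Finset.mem_range.1 hi
  rw [zero_pow (by omega)]
  ring

theorem antiE_totalDegree {σ : Type*} (t x : MvPolynomial σ ℚ) (ht : t.totalDegree ≤ 1)
    (hx : x.totalDegree ≤ 1) (m : ℕ) : (antiE t x m).totalDegree ≤ m + 1 := by
  induction m using Nat.strong_induction_on with
  | _ m ih =>
  rw [antiE]
  refine (MvPolynomial.totalDegree_smul_le _ _).trans ?_
  refine (MvPolynomial.totalDegree_sub _ _).trans (max_le ?_ ?_)
  · refine (MvPolynomial.totalDegree_pow _ _).trans ?_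
    nlinarith
  · refine MvPolynomial.totalDegree_finsetSum_le fun i _ => ?_
    refine (MvPolynomial.totalDegree_mul _ _).trans ?_
    have h1 := ih i i.2
    have h2 : (((m + 1).choose i : MvPolynomial σ ℚ) * t ^ (m - i)).totalDegree ≤ m - i := by
      refine (MvPolynomial.totalDegree_mul _ _).trans ?_
      have h3 : ((m + 1).choose i : MvPolynomial σ ℚ).totalDegree = 0 := by
        rw [← map_natCast (MvPolynomial.C : ℚ →+* MvPolynomial σ ℚ)]
        exact MvPolynomial.totalDegree_C _
      have := MvPolynomial.totalDegree_pow t (m - i)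
      nlinarith
    have := i.2
    omega

/-- Antidifference of `x ^ m * ∏ (x - y j)`. -/
noncomputable def antiT (J : Finset ℕ) (y : ℕ → R) (m : ℕ) (t x : R) : R :=
  ∑ s ∈ J.powerset, (∏ j ∈ s, (-y j)) * antiE t x (m + (J \ s).card)

theorem antiT_add (J : Finset ℕ) (y : ℕ → R) (m : ℕ) (t x : R) :
    antiT J y m t (x + t) - antiT J y m t x = t * (x ^ m * ∏ j ∈ J, (x - y j)) := by
  have : ∏ j ∈ J, (x - y j) = ∏ j ∈ J, (-y j + x) := Finset.prod_congr rfl fun _ _ => by ring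
  rw [this, Finset.prod_add, antiT, antiT, ← Finset.sum_sub_distrib, Finset.mul_sum,
    Finset.mul_sum]
  refine Finset.sum_congr rfl fun s _ => ?_
  rw [← mul_sub, antiE_add, Finset.prod_const, pow_add]
  ring

theorem antiT_dvd (J : Finset ℕ) (y : ℕ → R) (m : ℕ) (t x x' : R) :
    (x - x') ∣ antiT J y m t x - antiT J y m t x' := by
  rw [antiT, antiT, ← Finset.sum_sub_distrib]
  refine Finset.dvd_sum fun s _ => ?_
  rw [← mul_sub]
  exact (antiE_dvd _ _ _ _).mul_left _

theorem antiT_map {R' : Type*} [CommRing R'] [Algebra ℚ R'] (φ : R →+* R') (J : Finset ℕ)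
    (y : ℕ → R) (m : ℕ) (t x : R) :
    φ (antiT J y m t x) = antiT J (fun j => φ (y j)) m (φ t) (φ x) := by
  simp [antiT, antiE_map, map_sum, map_prod]

theorem antiT_totalDegree {σ : Type*} (J : Finset ℕ) (y : ℕ → MvPolynomial σ ℚ) (m : ℕ)
    (t x : MvPolynomial σ ℚ) (ht : t.totalDegree ≤ 1)
    (hx : x.totalDegree ≤ 1) (hy : ∀ j, (y j).totalDegree ≤ 1) :
    (antiT J y m t x).totalDegree ≤ m + J.card + 1 := by
  refine MvPolynomial.totalDegree_finsetSum_le fun s hs => ?_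
  have hs := Finset.mem_powerset.1 hs
  refine (MvPolynomial.totalDegree_mul _ _).trans ?_
  have h1 := antiE_totalDegree t x ht hx (m + (J \ s).card)
  have h2 : (∏ j ∈ s, (-y j)).totalDegree ≤ s.card := by
    refine (MvPolynomial.totalDegree_finsetProd _ _).trans ?_
    rw [Finset.card_eq_sum_ones]
    exact Finset.sum_le_sum fun j _ => by simpa using hy j
  have h3 := Finset.card_sdiff_add_card_eq_card hs
  omega

end Anti

section AntiPoly
open Polynomial

theorem antiE_derivative (m : ℕ) :
    derivative (antiE (0 : ℚ[X]) X m) = X ^ m := by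
  apply nat_cancel m
  have := congrArg derivative (antiE_zero_step (X : ℚ[X]) m)
  simpa [derivative_mul] using this

theorem antiE_natDegree (m : ℕ) : (antiE (0 : ℚ[X]) X m).natDegree ≤ m + 1 := by
  have h := antiE_zero_step (X : ℚ[X]) m
  have h2 : ((m : ℚ[X]) + 1) = C ((m : ℚ) + 1) := by simp
  rw [h2] at h
  rw [← natDegree_C_mul (a := (m : ℚ) + 1) (by positivity), h]
  simp

theorem antiT_derivative (J : Finset ℕ) (y : ℕ → ℚ) (m : ℕ) :
    derivative (antiT J (fun j => (C (y j) : ℚ[X])) m 0 X) = X ^ m * ∏ j ∈ J, (X - C (y j)) := by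
  have : ∏ j ∈ J, (X - C (y j)) = ∏ j ∈ J, (-C (y j) + X) :=
    Finset.prod_congr rfl fun _ _ => by ring
  rw [this, Finset.prod_add, antiT, derivative_sum, Finset.mul_sum]
  refine Finset.sum_congr rfl fun s _ => ?_
  have h : (∏ j ∈ s, (-C (y j)) : ℚ[X]) = C (∏ j ∈ s, (-y j)) := by simp [map_prod]
  rw [h, derivative_C_mul, antiE_derivative, Finset.prod_const, pow_add]
  ring

theorem antiT_natDegree (J : Finset ℕ) (y : ℕ → ℚ) (m : ℕ) :
    (antiT J (fun j => (C (y j) : ℚ[X])) m 0 X).natDegree ≤ m + J.card + 1 := by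
  refine natDegree_sum_le_of_forall_le _ _ fun s hs => ?_
  have hs := Finset.mem_powerset.1 hs
  have h : (∏ j ∈ s, (-C (y j)) : ℚ[X]) = C (∏ j ∈ s, (-y j)) := by simp [map_prod]
  rw [h]
  refine (natDegree_C_mul_le _ _).trans ((antiE_natDegree _).trans ?_)
  have h3 := Finset.card_sdiff_add_card_eq_card hs
  omega

end AntiPoly

section GraphPart

/-- Path vertices in the half-open interval `[i, j)`. -/
def iv (n i j : ℕ) : Finset (Fin (n + 1)) :=
  Finset.univ.filter (fun v => i ≤ v.val ∧ v.val < j)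

/-- Path vertices in the half-open interval `[i, j)` together with the apex. -/
def ivz (n i j : ℕ) : Finset (Fin (n + 1)) := insert (Fin.last n) (iv n i j)

theorem mem_iv {n i j : ℕ} {v : Fin (n + 1)} : v ∈ iv n i j ↔ i ≤ v.val ∧ v.val < j := by
  simp [iv]

theorem mem_ivz {n i j : ℕ} {v : Fin (n + 1)} :
    v ∈ ivz n i j ↔ v.val = n ∨ (i ≤ v.val ∧ v.val < j) := by
  simp [ivz, mem_iv, Fin.ext_iff]

theorem conn_cut {n : ℕ} {G : SimpleGraph (Fin n)} {I : Finset (Fin n)} (h : ConnSet G I)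
    (P : Fin n → Prop) {v w : Fin n} (hv : v ∈ I) (hw : w ∈ I) (hPv : P v) (hPw : ¬ P w) :
    ∃ a ∈ I, ∃ b ∈ I, P a ∧ ¬ P b ∧ G.Adj a b := by
  obtain ⟨p⟩ := h.2.preconnected ⟨v, hv⟩ ⟨w, hw⟩
  obtain ⟨d, _, h1, h2⟩ := p.exists_boundary_dart {x | P x.1} hPv hPw
  exact ⟨d.fst.1, d.fst.2, d.snd.1, d.snd.2, h1, h2, d.adj⟩

theorem pt_adj {n k : ℕ} {a b : Fin (n + 1)} (h : (pathTriangle n k).Adj a b) :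
    (a.val + 1 = b.val ∧ b.val < n) ∨ (b.val + 1 = a.val ∧ a.val < n) ∨
    (a.val = k - 1 ∧ b.val = n) ∨ (a.val = k ∧ b.val = n) ∨
    (b.val = k - 1 ∧ a.val = n) ∨ (b.val = k ∧ a.val = n) := by
  rw [pathTriangle, SimpleGraph.fromRel_adj] at h
  tauto

theorem exists_low (P : ℕ → Prop) (k : ℕ) (h : ∀ v c, v ≤ c → c < k → P v → P c) :
    ∃ i ≤ k, ∀ c < k, P c ↔ i ≤ c := by
  classical
  have hex : ∃ i, i = k ∨ P i := ⟨k, Or.inl rfl⟩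
  refine ⟨Nat.find hex, Nat.find_min' hex (Or.inl rfl), fun c hc => ⟨fun hp =>
    Nat.find_min' hex (Or.inr hp), fun hle => ?_⟩⟩
  rcases Nat.find_spec hex with h1 | h1
  · omega
  · exact h _ _ hle hc h1

theorem exists_high (P : ℕ → Prop) (k n : ℕ) (hkn : k ≤ n)
    (h : ∀ v c, k ≤ c → c ≤ v → v < n → P v → P c) :
    ∃ j, k ≤ j ∧ j ≤ n ∧ ∀ c, k ≤ c → c < n → (P c ↔ c < j) := by
  classical
  have hex : ∃ j, k ≤ j ∧ (j = n ∨ ¬ P j) := ⟨n, hkn, Or.inl rfl⟩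
  refine ⟨Nat.find hex, (Nat.find_spec hex).1, Nat.find_min' hex ⟨hkn, Or.inl rfl⟩,
    fun c hc hcn => ⟨fun hp => ?_, fun hlt => ?_⟩⟩
  · by_contra hcon
    push Not at hcon
    rcases (Nat.find_spec hex).2 with h1 | h1
    · omega
    · exact h1 (h _ _ (Nat.find_spec hex).1 hcon hcn hp)
  · have := Nat.find_min hex hlt
    push Not at this
    exact (this hc).2

theorem conn_classify {n k : ℕ} (h1 : 1 < k) (h2 : k < n) {I : Finset (Fin (n + 1))}
    (h : ConnSet (pathTriangle n k) I) :
    (∃ i j, i < j ∧ j ≤ n ∧ I = iv n i j) ∨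
    (∃ i j, i ≤ k ∧ k ≤ j ∧ j ≤ n ∧ I = ivz n i j) := by
  by_cases hn : Fin.last n ∈ I
  · right
    let P : ℕ → Prop := fun c => ∃ v ∈ I, v.val = c
    have hP : ∀ v : Fin (n + 1), P v.val ↔ v ∈ I := fun v =>
      ⟨fun ⟨w, hw, hwv⟩ => (Fin.ext hwv : w = v) ▸ hw, fun hv => ⟨v, hv, rfl⟩⟩
    obtain ⟨i, hik, hi⟩ := exists_low P k (by
      rintro _ c hvc hck ⟨v, hv, rfl⟩
      by_contra hc
      have hvc' : v.val ≠ c := fun h => hc ⟨v, hv, h⟩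
      obtain ⟨a, ha, b, hb, hPa, hPb, hab⟩ := conn_cut h (fun x => x.val < c) hv hn
        (by omega) (by simp; omega)
      have hbc : b.val ≠ c := fun h => hc ⟨b, hb, h⟩
      have := pt_adj hab
      omega)
    obtain ⟨j, hkj, hjn, hj⟩ := exists_high P k n h2.le (by
      rintro _ c hkc hcv hvn ⟨v, hv, rfl⟩
      by_contra hc
      have hvc' : v.val ≠ c := fun h => hc ⟨v, hv, h⟩
      obtain ⟨a, ha, b, hb, hPa, hPb, hab⟩ := conn_cut h (fun x => c < x.val ∧ x.val < n) hv hn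
        (by omega) (by simp)
      have hbc : b.val ≠ c := fun h => hc ⟨b, hb, h⟩
      have := pt_adj hab
      omega)
    refine ⟨i, j, hik, hkj, hjn, ?_⟩
    ext v
    rw [mem_ivz, ← hP]
    have hv := v.2
    rcases lt_trichotomy v.val n with hvn | hvn | hvn
    · by_cases hvk : v.val < k
      · rw [hi _ hvk]; omega
      · rw [hj _ (by omega) hvn]; omega
    · simp only [hvn, true_or, iff_true]
      exact ⟨Fin.last n, hn, rfl⟩
    · omega
  · left
    have hlt : ∀ v ∈ I, v.val < n := fun v hv => by
      have : v ≠ Fin.last n := fun h => hn (h ▸ hv)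
      have h3 : v.val ≠ n := fun h => this (Fin.ext h)
      omega
    have hne := h.1
    have hmin := Finset.min'_mem I hne
    have hmax := Finset.max'_mem I hne
    refine ⟨(I.min' hne).val, (I.max' hne).val + 1, ?_, ?_, ?_⟩
    · have := I.min'_le _ hmax
      rw [Fin.le_def] at this
      omega
    · exact hlt _ hmax
    · ext v
      rw [mem_iv]
      constructor
      · intro hv
        exact ⟨I.min'_le _ hv, Nat.lt_succ_of_le (I.le_max' _ hv)⟩
      · rintro ⟨ha, hb⟩
        by_contra hv
        have hv1 : (I.min' hne).val ≠ v.val := fun h => hv (Fin.ext h ▸ hmin)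
        have hv2 : (I.max' hne).val ≠ v.val := fun h => hv (Fin.ext h ▸ hmax)
        obtain ⟨a, ha, b, hb, hPa, hPb, hab⟩ := conn_cut h (fun x => x.val < v.val) hmin hmax
          (by omega) (by omega)
        have hbc : b.val ≠ v.val := fun h => hv (Fin.ext h ▸ hb)
        have := pt_adj hab
        have := hlt a ha
        have := hlt b hb
        omega

theorem pt_adj_path {n k : ℕ} {a b : Fin (n + 1)} (h : a.val + 1 = b.val) (hb : b.val < n) :
    (pathTriangle n k).Adj a b := by
  rw [pathTriangle, SimpleGraph.fromRel_adj]
  exact ⟨fun h' => by rw [h'] at h; omega, Or.inl (Or.inl ⟨h, hb⟩)⟩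

theorem pt_adj_apex {n k : ℕ} (hk : k < n) {a b : Fin (n + 1)} (h : a.val = k - 1 ∨ a.val = k)
    (hb : b.val = n) : (pathTriangle n k).Adj a b := by
  rw [pathTriangle, SimpleGraph.fromRel_adj]
  refine ⟨fun h' => by rw [h'] at h; omega, Or.inl (Or.inr ?_)⟩
  rcases h with h | h
  · exact Or.inl ⟨h, hb⟩
  · exact Or.inr ⟨h, hb⟩

theorem conn_singleton {n : ℕ} (G : SimpleGraph (Fin n)) (v : Fin n) : ConnSet G {v} := by
  refine ⟨⟨v, by simp⟩, ?_⟩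
  have : Nonempty ((({v} : Finset (Fin n)) : Set (Fin n))) := ⟨⟨v, by simp⟩⟩
  have : Subsingleton ((({v} : Finset (Fin n)) : Set (Fin n))) := by
    rw [Finset.coe_singleton]; infer_instance
  exact ⟨SimpleGraph.Preconnected.of_subsingleton⟩

theorem conn_insert {n : ℕ} (G : SimpleGraph (Fin n)) {v w : Fin n} {I : Finset (Fin n)}
    (hI : ConnSet G I) (hw : w ∈ I) (h : G.Adj w v) : ConnSet G (insert v I) := by
  refine ⟨⟨v, by simp⟩, ?_⟩
  have := SimpleGraph.connected_induce_union (G := G) (s := (I : Set (Fin n)))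
    (t := (({v} : Finset (Fin n)) : Set (Fin n))) hI.2.preconnected
    (conn_singleton G v).2.preconnected (v := w) (w := v) hw (by simp) h
  rw [Finset.insert_eq, Finset.union_comm, Finset.coe_union]
  exact this

theorem conn_iv {n k i j : ℕ} (hij : i < j) (hj : j ≤ n) :
    ConnSet (pathTriangle n k) (iv n i j) := by
  induction j, hij using Nat.le_induction with
  | base =>
    have : iv n i (i + 1) = {⟨i, by omega⟩} := by
      ext v
      simp only [mem_iv, Finset.mem_singleton, Fin.ext_iff]
      omega
    rw [this]
    exact conn_singleton _ _
  | succ j hij ih =>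
    have : iv n i (j + 1) = insert ⟨j, by omega⟩ (iv n i j) := by
      ext v
      simp only [mem_iv, Finset.mem_insert, Fin.ext_iff]
      omega
    rw [this]
    refine conn_insert _ (ih (by omega)) (w := ⟨j - 1, by omega⟩) ?_ (pt_adj_path ?_ ?_)
    · rw [mem_iv]; simp; omega
    · simp; omega
    · simp; omega

theorem conn_ivz {n k i j : ℕ} (h1 : 1 < k) (h2 : k < n) (hi : i ≤ k) (hkj : k ≤ j) (hj : j ≤ n) :
    ConnSet (pathTriangle n k) (ivz n i j) := by
  rcases lt_or_ge i j with hij | hij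
  · by_cases hik : i < k
    · exact conn_insert _ (conn_iv hij hj) (w := ⟨k - 1, by omega⟩) (by rw [mem_iv]; simp; omega)
        (pt_adj_apex h2 (Or.inl rfl) rfl)
    · exact conn_insert _ (conn_iv hij hj) (w := ⟨k, by omega⟩) (by rw [mem_iv]; simp; omega)
        (pt_adj_apex h2 (Or.inr rfl) rfl)
  · have : ivz n i j = {Fin.last n} := by
      ext v
      simp only [mem_ivz, Finset.mem_singleton, Fin.ext_iff, Fin.val_last]
      omega
    rw [this]
    exact conn_singleton _ _

/-- The set of all connected vertex sets. -/
noncomputable def connFin {n : ℕ} (G : SimpleGraph (Fin n)) : Finset (Finset (Fin n)) := by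
  classical exact Finset.univ.filter (fun I => ConnSet G I)

theorem mem_connFin {n : ℕ} {G : SimpleGraph (Fin n)} {I : Finset (Fin n)} :
    I ∈ connFin G ↔ ConnSet G I := by
  classical simp [connFin]

theorem card_connFin {n k : ℕ} (h1 : 1 < k) (h2 : k < n) :
    (∑ j ∈ Finset.range (n + 1), j) + (k + 1) * (n + 1 - k) ≤
      (connFin (pathTriangle n k)).card := by
  classical
  let A : Finset (Finset (Fin (n + 1))) :=
    ((Finset.range (n + 1)).sigma (fun j => Finset.range j)).image (fun p => iv n p.2 p.1)
  let B : Finset (Finset (Fin (n + 1))) :=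
    (Finset.range (k + 1) ×ˢ Finset.Icc k n).image (fun p => ivz n p.1 p.2)
  have hA : A.card = ∑ j ∈ Finset.range (n + 1), j := by
    rw [Finset.card_image_of_injOn, Finset.card_sigma]
    · simp
    · rintro ⟨j, i⟩ hp ⟨j', i'⟩ hp' heq
      simp only [Finset.coe_sigma, Set.mem_sigma_iff, Finset.mem_coe, Finset.mem_range] at hp hp'
      simp only [Finset.ext_iff, mem_iv] at heq
      have e1 := heq ⟨i, by omega⟩
      have e2 := heq ⟨i', by omega⟩
      have e3 := heq ⟨j - 1, by omega⟩
      have e4 := heq ⟨j' - 1, by omega⟩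
      simp only at e1 e2 e3 e4
      obtain ⟨rfl, rfl⟩ : i = i' ∧ j = j' := by omega
      rfl
  have hB : B.card = (k + 1) * (n + 1 - k) := by
    rw [Finset.card_image_of_injOn, Finset.card_product]
    · simp
    · rintro ⟨i, j⟩ hp ⟨i', j'⟩ hp' heq
      simp only [Finset.coe_product, Set.mem_prod, Finset.mem_coe, Finset.mem_range,
        Finset.mem_Icc] at hp hp'
      simp only [Finset.ext_iff, mem_ivz] at heq
      have e1 := heq ⟨i, by omega⟩
      have e2 := heq ⟨i', by omega⟩
      have e3 := heq ⟨j - 1, by omega⟩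
      have e4 := heq ⟨j' - 1, by omega⟩
      simp only at e1 e2 e3 e4
      obtain ⟨rfl, rfl⟩ : i = i' ∧ j = j' := by omega
      rfl
  have hAB : Disjoint A B := by
    rw [Finset.disjoint_left]
    intro I hIA hIB
    obtain ⟨⟨j, i⟩, hp, rfl⟩ := Finset.mem_image.1 hIA
    obtain ⟨⟨i', j'⟩, hp', heq⟩ := Finset.mem_image.1 hIB
    simp only [Finset.mem_sigma, Finset.mem_range] at hp
    have : Fin.last n ∈ ivz n i' j' := by simp [ivz]
    simp only at heq
    rw [heq, mem_iv] at this
    simp at this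
    omega
  rw [← hA, ← hB, ← Finset.card_union_of_disjoint hAB]
  refine Finset.card_le_card (Finset.union_subset ?_ ?_)
  · intro I hI
    obtain ⟨⟨j, i⟩, hp, rfl⟩ := Finset.mem_image.1 hI
    simp only [Finset.mem_sigma, Finset.mem_range] at hp
    exact mem_connFin.2 (conn_iv hp.2 (Nat.lt_succ_iff.1 hp.1))
  · intro I hI
    obtain ⟨⟨i, j⟩, hp, rfl⟩ := Finset.mem_image.1 hI
    simp only [Finset.mem_product, Finset.mem_range, Finset.mem_Icc] at hp
    exact mem_connFin.2 (conn_ivz h1 h2 (by omega) hp.2.1 hp.2.2)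

end GraphPart

section Saito
open MvPolynomial

/-- The linear form of a vertex set. -/
noncomputable def lf {n : ℕ} (I : Finset (Fin n)) : MvPolynomial (Fin n) ℚ := ∑ i ∈ I, X i

theorem lf_coeff {n : ℕ} (I : Finset (Fin n)) (i : Fin n) :
    (lf I).coeff (Finsupp.single i 1) = if i ∈ I then 1 else 0 := by
  classical
  rw [lf, coeff_sum]
  simp only [coeff_X]
  simp [Finsupp.single_left_inj]

theorem lf_totalDegree_le {n : ℕ} (I : Finset (Fin n)) : (lf I).totalDegree ≤ 1 :=
  totalDegree_finsetSum_le fun i _ => (totalDegree_X i).le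

theorem lf_ne_zero {n : ℕ} {I : Finset (Fin n)} (h : I.Nonempty) : lf I ≠ 0 := by
  obtain ⟨i, hi⟩ := h
  intro h0
  have := lf_coeff I i
  simp [h0, hi] at this

theorem lf_totalDegree {n : ℕ} {I : Finset (Fin n)} (h : I.Nonempty) :
    (lf I).totalDegree = 1 := by
  refine le_antisymm (lf_totalDegree_le I) ?_
  obtain ⟨i, hi⟩ := h
  have hs : Finsupp.single i 1 ∈ (lf I).support := by
    rw [mem_support_iff, lf_coeff]; simp [hi]
  have := le_totalDegree hs
  simpa using this

theorem lf_irreducible {n : ℕ} {I : Finset (Fin n)} (h : I.Nonempty) : Irreducible (lf I) := by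
  refine irreducible_of_totalDegree_eq_one (lf_totalDegree h) fun x hx => ?_
  obtain ⟨i, hi⟩ := h
  have := hx (Finsupp.single i 1)
  rw [lf_coeff, if_pos hi] at this
  exact isUnit_of_dvd_one this

theorem lf_relPrime {n : ℕ} {I J : Finset (Fin n)} (hI : I.Nonempty) (hJ : J.Nonempty)
    (hIJ : I ≠ J) : IsRelPrime (lf I) (lf J) := by
  rw [(lf_irreducible hI).isRelPrime_iff_not_dvd]
  rintro ⟨c, hc⟩
  have hc0 : c ≠ 0 := by rintro rfl; exact lf_ne_zero hJ (by simpa using hc)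
  have hd := congrArg totalDegree hc
  rw [totalDegree_mul_of_isDomain (lf_ne_zero hI) hc0, lf_totalDegree hI, lf_totalDegree hJ] at hd
  obtain ⟨r, rfl⟩ : ∃ r, c = C r := ⟨_, (totalDegree_eq_zero_iff_eq_C (p := c)).mp (by omega)⟩
  have key : ∀ i, (if i ∈ J then (1 : ℚ) else 0) = (if i ∈ I then 1 else 0) * r := by
    intro i
    rw [← lf_coeff, ← lf_coeff, hc, mul_comm, coeff_C_mul, mul_comm]
  obtain ⟨j, hj⟩ := hJ
  have hr : r = 1 := by
    have := key j
    rw [if_pos hj] at this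
    split_ifs at this <;> linarith
  subst hr
  apply hIJ
  ext i
  have := key i
  by_cases h1 : i ∈ I <;> by_cases h2 : i ∈ J <;> simp [h1, h2] at this ⊢

/-- The defining polynomial of the arrangement. -/
noncomputable def defPoly {n : ℕ} (G : SimpleGraph (Fin n)) : MvPolynomial (Fin n) ℚ :=
  ∏ I ∈ connFin G, lf I

theorem defPoly_ne_zero {n : ℕ} (G : SimpleGraph (Fin n)) : defPoly G ≠ 0 :=
  Finset.prod_ne_zero_iff.2 fun _ hI => lf_ne_zero (mem_connFin.1 hI).1

theorem defPoly_totalDegree {n : ℕ} (G : SimpleGraph (Fin n)) :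
    (defPoly G).totalDegree = (connFin G).card := by
  have : ∀ s : Finset (Finset (Fin n)), (∀ I ∈ s, I.Nonempty) →
      (∏ I ∈ s, lf I).totalDegree = s.card := by
    classical
    intro s
    induction s using Finset.induction_on with
    | empty => simp
    | insert I s hI ih =>
      intro h
      rw [Finset.prod_insert hI, Finset.card_insert_of_notMem hI, totalDegree_mul_of_isDomain,
        ih fun J hJ => h J (Finset.mem_insert_of_mem hJ),
        lf_totalDegree (h I (Finset.mem_insert_self _ _)), add_comm]
      · exact lf_ne_zero (h I (Finset.mem_insert_self _ _))
      · exact Finset.prod_ne_zero_iff.2 fun J hJ => lf_ne_zero (h J (Finset.mem_insert_of_mem hJ))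
  exact this _ fun I hI => (mem_connFin.1 hI).1

theorem defPoly_dvd_det {n : ℕ} (G : SimpleGraph (Fin n))
    (N : Matrix (Fin n) (Fin n) (MvPolynomial (Fin n) ℚ))
    (hN : ∀ r, ∀ I, ConnSet G I → lf I ∣ ∑ i ∈ I, N r i) : defPoly G ∣ N.det := by
  classical
  refine Finset.prod_dvd_of_isRelPrime ?_ ?_
  · intro I hI J hJ hIJ
    exact lf_relPrime (mem_connFin.1 hI).1 (mem_connFin.1 hJ).1 hIJ
  · intro I hI
    have hI := mem_connFin.1 hI
    choose w hw using fun r => hN r I hI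
    obtain ⟨i, hi⟩ := hI.1
    let e : Fin n → MvPolynomial (Fin n) ℚ := fun j => if j ∈ I then 1 else 0
    have h1 : N.mulVec e = lf I • w := by
      ext1 r
      simp only [Matrix.mulVec, dotProduct, e, mul_ite, mul_one, mul_zero, Pi.smul_apply,
        smul_eq_mul, ← hw r, Finset.sum_ite_mem, Finset.univ_inter]
    have h2 : N.adjugate.mulVec (N.mulVec e) = N.det • e := by
      rw [Matrix.mulVec_mulVec, Matrix.adjugate_mul, Matrix.smul_mulVec, Matrix.one_mulVec]
    rw [h1, Matrix.mulVec_smul] at h2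
    have h3 := congrFun h2 i
    simp only [Pi.smul_apply, smul_eq_mul, e, if_pos hi, mul_one] at h3
    exact ⟨_, h3.symm⟩

theorem det_totalDegree {n : ℕ} {σ : Type*} (N : Matrix (Fin n) (Fin n) (MvPolynomial σ ℚ))
    (d : Fin n → ℕ) (h : ∀ r c, (N r c).totalDegree ≤ d r) : N.det.totalDegree ≤ ∑ r, d r := by
  rw [Matrix.det_apply]
  refine totalDegree_finsetSum_le fun τ _ => ?_
  rw [Units.smul_def, zsmul_eq_mul]
  refine (totalDegree_mul _ _).trans ?_
  have h1 : (((Equiv.Perm.sign τ : ℤˣ) : ℤ) : MvPolynomial σ ℚ).totalDegree = 0 := by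
    rw [← map_intCast (C : ℚ →+* MvPolynomial σ ℚ)]
    exact totalDegree_C _
  rw [h1, zero_add]
  refine (totalDegree_finsetProd _ _).trans ?_
  rw [← Equiv.sum_comp τ d]
  exact Finset.sum_le_sum fun i _ => h _ _

theorem mem_derModule_iff {n : ℕ} (G : SimpleGraph (Fin n))
    (θ : Derivation ℚ (MvPolynomial (Fin n) ℚ) (MvPolynomial (Fin n) ℚ)) :
    θ ∈ derModule G ↔ ∀ I, ConnSet G I → lf I ∣ ∑ i ∈ I, θ (X i) := by
  change (∀ I : Finset (Fin n), ConnSet G I → (∑ i ∈ I, X i) ∣ θ (∑ i ∈ I, X i)) ↔ _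
  simp only [map_sum]
  rfl

theorem free_of_gen {R V ι : Type*} [CommRing R] [AddCommGroup V] [Module R V] [Fintype ι]
    (D : Submodule R V) (b : ι → V) (hb : ∀ i, b i ∈ D)
    (hli : ∀ g : ι → R, ∑ i, g i • b i = 0 → ∀ i, g i = 0)
    (hsp : ∀ θ ∈ D, ∃ g : ι → R, θ = ∑ i, g i • b i) : Module.Free R D := by
  have hD : D = Submodule.span R (Set.range b) := by
    apply le_antisymm
    · intro θ hθ
      obtain ⟨g, rfl⟩ := hsp θ hθ
      exact Submodule.sum_mem _ fun r _ => Submodule.smul_mem _ _ (Submodule.subset_span ⟨r, rfl⟩)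
    · rw [Submodule.span_le]
      rintro _ ⟨i, rfl⟩
      exact hb i
  rw [hD]
  exact Module.Free.of_basis (Module.Basis.span (Fintype.linearIndependent_iff.2 hli))

theorem saito {n : ℕ} (G : SimpleGraph (Fin n))
    (M : Matrix (Fin n) (Fin n) (MvPolynomial (Fin n) ℚ)) (d : Fin n → ℕ)
    (hM : ∀ r, ∀ I, ConnSet G I → lf I ∣ ∑ i ∈ I, M r i)
    (hd : ∀ r c, (M r c).totalDegree ≤ d r)
    (hcard : ∑ r, d r ≤ (connFin G).card) (hdet : M.det ≠ 0) :
    Module.Free (MvPolynomial (Fin n) ℚ) (derModule G) := by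
  classical
  obtain ⟨c, hc⟩ := defPoly_dvd_det G M hM
  have hc0 : c ≠ 0 := by rintro rfl; exact hdet (by simpa using hc)
  have h1 := det_totalDegree M d hd
  rw [hc, totalDegree_mul_of_isDomain (defPoly_ne_zero G) hc0, defPoly_totalDegree] at h1
  obtain ⟨q, rfl⟩ : ∃ r, c = C r := ⟨_, (totalDegree_eq_zero_iff_eq_C (p := c)).mp (by omega)⟩
  have hq : q ≠ 0 := by rintro rfl; simp at hc0
  let b : Fin n → Derivation ℚ (MvPolynomial (Fin n) ℚ) (MvPolynomial (Fin n) ℚ) :=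
    fun r => mkDerivation ℚ (M r)
  have hb : ∀ r i, b r (X i) = M r i := fun r i => mkDerivation_X _ _ _
  have happ : ∀ (g : Fin n → MvPolynomial (Fin n) ℚ) i,
      (∑ r, g r • b r) (X i) = ∑ r, g r * M r i := by
    intro g i
    have h := map_sum (Derivation.coeFnAddMonoidHom (R := ℚ) (A := MvPolynomial (Fin n) ℚ)
      (M := MvPolynomial (Fin n) ℚ)) (fun r => g r • b r) Finset.univ
    have h' := congrFun h (X i)
    rw [Finset.sum_apply] at h'
    refine h'.trans (Finset.sum_congr rfl fun r _ => ?_)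
    change (g r • b r) (X i) = _
    rw [Derivation.smul_apply, hb, smul_eq_mul]
  refine free_of_gen (derModule G) b ?_ ?_ ?_
  · intro r
    rw [mem_derModule_iff]
    simpa only [hb] using hM r
  · intro g hg
    have : Matrix.vecMul g M = 0 := by
      ext1 i
      have := happ g i
      rw [hg] at this
      simp only [Matrix.vecMul, dotProduct]
      rw [← this]
      rfl
    have := Matrix.eq_zero_of_vecMul_eq_zero hdet this
    exact fun i => congrFun this i
  · intro θ hθ
    have hθ := (mem_derModule_iff G θ).1 hθ
    let v : Fin n → MvPolynomial (Fin n) ℚ := fun i => θ (X i)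
    have hdv : ∀ r, defPoly G ∣ (M.updateRow r v).det := by
      intro r
      refine defPoly_dvd_det G _ fun r' I hI => ?_
      by_cases hr : r' = r
      · subst hr
        simp only [Matrix.updateRow_self]
        exact hθ I hI
      · simp only [Matrix.updateRow_ne hr]
        exact hM r' I hI
    choose w hw using hdv
    have key := Matrix.mulVec_cramer M.transpose v
    refine ⟨fun r => C q⁻¹ * w r, MvPolynomial.derivation_ext fun i => ?_⟩
    rw [happ]
    have k1 := congrFun key i
    simp only [Matrix.mulVec, dotProduct, Matrix.cramer_transpose_apply, hw,
      Matrix.transpose_apply, Matrix.det_transpose, hc, Pi.smul_apply, smul_eq_mul, v] at k1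
    have hqq : (C q * C q⁻¹ : MvPolynomial (Fin n) ℚ) = 1 := by
      rw [← C_mul, mul_inv_cancel₀ hq, C_1]
    have hne : defPoly G * C q ≠ 0 := mul_ne_zero (defPoly_ne_zero G) hc0
    apply mul_left_cancel₀ hne
    rw [← k1, Finset.mul_sum]
    refine Finset.sum_congr rfl fun r _ => ?_
    linear_combination (-(defPoly G * w r * M r i)) * hqq

end Saito

section Indep
open Polynomial

/-- The antiderivative polynomials at `t = 0`. -/
noncomputable def polyH (n k : ℕ) (y : ℕ → ℚ) (r : ℕ) : ℚ[X] :=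
  if r < k then antiT (Finset.Icc k n) (fun j => (C (y j) : ℚ[X])) r 0 X
  else antiT (Finset.range (k + 1)) (fun j => (C (y j) : ℚ[X])) (r - k) 0 X

theorem polyH_natDegree {n k : ℕ} (hk : k < n) (y : ℕ → ℚ) {r : ℕ} (hr : r < n) :
    (polyH n k y r).natDegree ≤ n + 1 := by
  unfold polyH
  split_ifs with h
  · refine (antiT_natDegree _ _ _).trans ?_
    simp
    omega
  · refine (antiT_natDegree _ _ _).trans ?_
    simp
    omega

theorem polyH_derivative_low {n k : ℕ} (y : ℕ → ℚ) {r : ℕ} (h : r < k) :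
    derivative (polyH n k y r) = X ^ r * ∏ j ∈ Finset.Icc k n, (X - C (y j)) := by
  rw [polyH, if_pos h, antiT_derivative]

theorem polyH_derivative_high {n k : ℕ} (y : ℕ → ℚ) {r : ℕ} (h : k ≤ r) :
    derivative (polyH n k y r) = X ^ (r - k) * ∏ j ∈ Finset.range (k + 1), (X - C (y j)) := by
  rw [polyH, if_neg (by omega), antiT_derivative]

theorem eval_prod_zero {J : Finset ℕ} (y : ℕ → ℚ) {i : ℕ} (hi : i ∈ J) :
    (∏ j ∈ J, (X - C (y j))).eval (y i) = 0 := by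
  rw [eval_prod]
  exact Finset.prod_eq_zero hi (by simp)

theorem eval_prod_ne_zero {n : ℕ} {J : Finset ℕ} (y : ℕ → ℚ)
    (hy : ∀ i ≤ n, ∀ j ≤ n, y i = y j → i = j) {i : ℕ} (hin : i ≤ n) (hJ : ∀ j ∈ J, j ≤ n)
    (hi : i ∉ J) : (∏ j ∈ J, (X - C (y j))).eval (y i) ≠ 0 := by
  rw [eval_prod, Finset.prod_ne_zero_iff]
  intro j hj h0
  simp only [eval_sub, eval_X, eval_C] at h0
  have := hy i hin j (hJ j hj) (by linarith)
  exact hi (this ▸ hj)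

theorem vand {m : ℕ} (x a : ℕ → ℚ) (hx : ∀ i < m, ∀ j < m, x i = x j → i = j)
    (h : ∀ i < m, ∑ r ∈ Finset.range m, a r * x i ^ r = 0) : ∀ r < m, a r = 0 := by
  have := Matrix.eq_zero_of_forall_index_sum_pow_mul_eq_zero (R := ℚ)
    (f := fun i : Fin m => x i) (v := fun i : Fin m => a i)
    (fun i j hij => Fin.ext (hx i i.2 j j.2 hij)) (fun j => by
      have := h j j.2
      rw [Finset.sum_range] at this
      rw [← this]
      exact Finset.sum_congr rfl fun i _ => mul_comm _ _)
  exact fun r hr => congrFun this ⟨r, hr⟩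

theorem polyH_indep {n k : ℕ} (hk : k < n) (y : ℕ → ℚ)
    (hy : ∀ i ≤ n, ∀ j ≤ n, y i = y j → i = j) (v : ℕ → ℚ)
    (h : ∀ c < n, ∑ r ∈ Finset.range n,
      v r * ((polyH n k y r).eval (y (c + 1)) - (polyH n k y r).eval (y c)) = 0) :
    ∀ r < n, v r = 0 := by
  set H : ℚ[X] := ∑ r ∈ Finset.range n, C (v r) * polyH n k y r with hH
  have hHd : H.natDegree ≤ n + 1 := natDegree_sum_le_of_forall_le _ _ fun r hr =>
    (natDegree_C_mul_le _ _).trans (polyH_natDegree hk y (Finset.mem_range.1 hr))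
  have hHe : ∀ x, H.eval x = ∑ r ∈ Finset.range n, v r * (polyH n k y r).eval x := fun x => by
    simp [hH, eval_finsetSum]
  have hHD : ∀ x, (derivative H).eval x =
      ∑ r ∈ Finset.range n, v r * (derivative (polyH n k y r)).eval x := fun x => by
    simp [hH, eval_finsetSum]
  have hconst : ∀ c ≤ n, H.eval (y c) = H.eval (y 0) := by
    intro c
    induction c with
    | zero => intro _; rfl
    | succ c ih =>
      intro hc
      rw [← ih (by omega)]
      have := h c (by omega)
      simp only [mul_sub, Finset.sum_sub_distrib] at this
      rw [hHe, hHe]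
      linarith
  set K := H - C (H.eval (y 0)) with hK
  have hKd : K.natDegree ≤ n + 1 := (natDegree_sub_C (p := H)).le.trans hHd
  have hK0 : ∀ c ≤ n, K.eval (y c) = 0 := fun c hc => by simp [hK, hconst c hc]
  have hKD : derivative K = derivative H := by simp [hK]
  have hDk : (derivative H).eval (y k) = 0 := by
    rw [hHD]
    refine Finset.sum_eq_zero fun r _ => ?_
    by_cases hr : r < k
    · rw [polyH_derivative_low y hr, eval_mul, eval_prod_zero y (by simp; omega)]
      ring
    · rw [polyH_derivative_high y (by omega), eval_mul, eval_prod_zero y (by simp)]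
      ring
  obtain ⟨L, hL⟩ := dvd_iff_isRoot.2 (hK0 k hk.le : K.IsRoot (y k))
  have hLk : L.eval (y k) = 0 := by
    rw [← hKD, hL] at hDk
    simpa [derivative_mul] using hDk
  have hL0 : L = 0 := by
    by_contra hne
    have hdeg : K.natDegree = 1 + L.natDegree := by
      rw [hL, natDegree_mul (X_sub_C_ne_zero _) hne, natDegree_X_sub_C]
    refine hne (eq_zero_of_natDegree_lt_card_of_eval_eq_zero L (f := fun i : Fin (n + 1) => y i)
      (fun i j hij => Fin.ext (hy i (by omega) j (by omega) hij)) (fun i => ?_)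
      (by simp; omega))
    by_cases hik : i.val = k
    · simp only [hik, hLk]
    · have h1 := hK0 i (by omega)
      rw [hL, eval_mul] at h1
      refine (mul_eq_zero.1 h1).resolve_left fun h2 => hik ?_
      simp only [eval_sub, eval_X, eval_C] at h2
      exact hy i (by omega) k hk.le (by linarith)
  have hH' : derivative H = 0 := by rw [← hKD, hL, hL0]; simp
  obtain ⟨b, rfl⟩ : ∃ b, n = k + b := ⟨n - k, by omega⟩
  have hsplit : ∀ x, (∑ r ∈ Finset.range k, v r * x ^ r) *
        (∏ j ∈ Finset.Icc k (k + b), (X - C (y j))).eval x +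
      (∑ r ∈ Finset.range b, v (k + r) * x ^ r) *
        (∏ j ∈ Finset.range (k + 1), (X - C (y j))).eval x = 0 := by
    intro x
    have h1 := hHD x
    rw [hH', eval_zero, Finset.sum_range_add] at h1
    rw [h1, Finset.sum_mul, Finset.sum_mul]
    congr 1
    · refine Finset.sum_congr rfl fun r hr => ?_
      rw [polyH_derivative_low y (Finset.mem_range.1 hr)]
      simp only [eval_mul, eval_pow, eval_X]
      ring
    · refine Finset.sum_congr rfl fun r hr => ?_
      rw [polyH_derivative_high y (by omega)]
      simp only [eval_mul, eval_pow, eval_X, Nat.add_sub_cancel_left]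
      ring
  have hlow := vand (m := k) y v (fun i hi j hj => hy i (by omega) j (by omega)) (fun i hi => by
    have h1 := hsplit (y i)
    rw [eval_prod_zero (J := Finset.range (k + 1)) y (by simp; omega), mul_zero, add_zero] at h1
    exact (mul_eq_zero.1 h1).resolve_right (eval_prod_ne_zero (n := k + b) y hy (by omega)
      (fun j hj => (Finset.mem_Icc.1 hj).2) (by simp; omega)))
  have hhigh := vand (m := b) (fun i => y (k + 1 + i)) (fun r => v (k + r))
    (fun i hi j hj hij => by
      have := hy (k + 1 + i) (by omega) (k + 1 + j) (by omega) hij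
      omega) (fun i hi => by
    have h1 := hsplit (y (k + 1 + i))
    rw [eval_prod_zero (J := Finset.Icc k (k + b)) y (by simp; omega), mul_zero, zero_add] at h1
    exact (mul_eq_zero.1 h1).resolve_right (eval_prod_ne_zero (n := k + b) y hy (by omega)
      (fun j hj => by have := Finset.mem_range.1 hj; omega) (by simp; omega)))
  intro r hr
  by_cases hrk : r < k
  · exact hlow r hrk
  · have := hhigh (r - k) (by omega)
    simpa [Nat.add_sub_cancel' (not_lt.1 hrk)] using this

end Indep

section Final
open MvPolynomial

/-- Partial sums of the path variables. -/
noncomputable def yv (n i : ℕ) : MvPolynomial (Fin (n + 1)) ℚ := lf (iv n 0 i)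

theorem sum_iv {n : ℕ} {R : Type*} [AddCommGroup R] (f : Fin (n + 1) → R) (g : ℕ → R)
    (hf : ∀ v : Fin (n + 1), v.val < n → f v = g (v.val + 1) - g v.val) {i j : ℕ} (hij : i ≤ j)
    (hj : j ≤ n) : ∑ v ∈ iv n i j, f v = g j - g i := by
  induction j, hij using Nat.le_induction with
  | base =>
    have : iv n i i = ∅ := by
      ext v
      simp only [mem_iv, Finset.notMem_empty, iff_false]
      omega
    rw [this]
    simp
  | succ j hij ih =>
    have : iv n i (j + 1) = insert ⟨j, by omega⟩ (iv n i j) := by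
      ext v
      simp only [mem_iv, Finset.mem_insert, Fin.ext_iff]
      omega
    rw [this, Finset.sum_insert (by simp [mem_iv]), ih (by omega), hf _ (by simp; omega)]
    simp

theorem yv_succ {n : ℕ} (v : Fin (n + 1)) : X v = yv n (v.val + 1) - yv n v.val := by
  have : iv n 0 (v.val + 1) = insert v (iv n 0 v.val) := by
    ext w
    simp only [mem_iv, Finset.mem_insert, Fin.ext_iff]
    omega
  rw [yv, yv, lf, lf, this, Finset.sum_insert (by simp [mem_iv])]
  ring

theorem lf_iv {n i j : ℕ} (hij : i ≤ j) (hj : j ≤ n) : lf (iv n i j) = yv n j - yv n i :=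
  sum_iv _ _ (fun v _ => yv_succ v) hij hj

theorem sum_ivz {n i j : ℕ} (hj : j ≤ n) {R : Type*} [AddCommGroup R] (f : Fin (n + 1) → R) :
    ∑ v ∈ ivz n i j, f v = f (Fin.last n) + ∑ v ∈ iv n i j, f v := by
  rw [ivz, Finset.sum_insert (by simp [mem_iv]; omega)]

/-- The univariate functions defining the basis derivations. -/
noncomputable def rowT (n k r : ℕ) (x : MvPolynomial (Fin (n + 1)) ℚ) :
    MvPolynomial (Fin (n + 1)) ℚ :=
  if r < k then antiT (Finset.Icc k n) (yv n) r (X (Fin.last n)) x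
  else antiT (Finset.range (k + 1)) (yv n) (r - k) (-X (Fin.last n)) x

/-- The coefficient matrix of the basis derivations. -/
noncomputable def saitoM (n k : ℕ) :
    Matrix (Fin (n + 1)) (Fin (n + 1)) (MvPolynomial (Fin (n + 1)) ℚ) := fun r c =>
  if r.val = n then X c else if c.val = n then 0 else
    rowT n k r (yv n (c.val + 1)) - rowT n k r (yv n c.val)

/-- Degrees of the basis derivations. -/
def rowD (n k r : ℕ) : ℕ :=
  if r = n then 1 else if r < k then r + (n + 1 - k) + 1 else (r - k) + (k + 1) + 1

theorem rowT_dvd (n k r : ℕ) (x x' : MvPolynomial (Fin (n + 1)) ℚ) :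
    x - x' ∣ rowT n k r x - rowT n k r x' := by
  unfold rowT
  split_ifs <;> exact antiT_dvd _ _ _ _ _ _

theorem rowT_dvd_shift (n k r : ℕ) {i j : ℕ} (hi : i ≤ k) (hkj : k ≤ j) (hj : j ≤ n) :
    X (Fin.last n) + (yv n j - yv n i) ∣ rowT n k r (yv n j) - rowT n k r (yv n i) := by
  unfold rowT
  split_ifs with h
  · have h1 := antiT_add (Finset.Icc k n) (yv n) r (X (Fin.last n)) (yv n j)
    rw [Finset.prod_eq_zero (Finset.mem_Icc.2 ⟨hkj, hj⟩) (sub_self _), mul_zero, mul_zero] at h1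
    rw [← sub_eq_zero.1 h1]
    convert antiT_dvd (Finset.Icc k n) (yv n) r (X (Fin.last n)) (yv n j + X (Fin.last n))
      (yv n i) using 1
    ring
  · have h1 := antiT_add (Finset.range (k + 1)) (yv n) (r - k) (-X (Fin.last n)) (yv n i)
    rw [Finset.prod_eq_zero (Finset.mem_range.2 (by omega)) (sub_self _), mul_zero, mul_zero] at h1
    rw [← sub_eq_zero.1 h1]
    convert antiT_dvd (Finset.range (k + 1)) (yv n) (r - k) (-X (Fin.last n)) (yv n j)
      (yv n i + -X (Fin.last n)) using 1
    ring

theorem saitoM_mem {n k : ℕ} (h1 : 1 < k) (h2 : k < n) (r : Fin (n + 1))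
    (I : Finset (Fin (n + 1))) (hI : ConnSet (pathTriangle n k) I) :
    lf I ∣ ∑ i ∈ I, saitoM n k r i := by
  by_cases hr : r.val = n
  · simp only [saitoM, if_pos hr]
    exact dvd_rfl
  · have hs : ∀ v : Fin (n + 1), v.val < n →
        saitoM n k r v = rowT n k r (yv n (v.val + 1)) - rowT n k r (yv n v.val) := by
      intro v hv
      rw [saitoM, if_neg hr, if_neg (by omega)]
    rcases conn_classify h1 h2 hI with ⟨i, j, hij, hj, rfl⟩ | ⟨i, j, hi, hkj, hj, rfl⟩
    · rw [lf_iv hij.le hj, sum_iv _ (fun c => rowT n k r (yv n c)) hs hij.le hj]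
      exact rowT_dvd _ _ _ _ _
    · have hl : saitoM n k r (Fin.last n) = 0 := by
        rw [saitoM, if_neg hr, if_pos (by simp)]
      rw [sum_ivz hj, sum_iv _ (fun c => rowT n k r (yv n c)) hs (hi.trans hkj) hj, hl, zero_add]
      have hlf : lf (ivz n i j) = X (Fin.last n) + (yv n j - yv n i) := by
        rw [← lf_iv (hi.trans hkj) hj]
        exact sum_ivz hj _
      rw [hlf]
      exact rowT_dvd_shift n k r hi hkj hj

theorem rowT_totalDegree {n k r : ℕ} (hr : r ≠ n) (i : ℕ) :
    (rowT n k r (yv n i)).totalDegree ≤ rowD n k r := by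
  have hX : (X (Fin.last n) : MvPolynomial (Fin (n + 1)) ℚ).totalDegree ≤ 1 :=
    (totalDegree_X _).le
  unfold rowT rowD
  rw [if_neg hr]
  split_ifs with h
  · have := antiT_totalDegree (Finset.Icc k n) (yv n) r _ (yv n i) hX (lf_totalDegree_le _)
      (fun j => lf_totalDegree_le _)
    simpa using this
  · have := antiT_totalDegree (Finset.range (k + 1)) (yv n) (r - k) (-X (Fin.last n)) (yv n i)
      (by simp) (lf_totalDegree_le _) (fun j => lf_totalDegree_le _)
    simpa using this

theorem saitoM_totalDegree {n k : ℕ} (r c : Fin (n + 1)) :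
    (saitoM n k r c).totalDegree ≤ rowD n k r := by
  unfold saitoM
  split_ifs with h h'
  · rw [rowD, if_pos h, totalDegree_X]
  · simp
  · exact (totalDegree_sub _ _).trans (max_le (rowT_totalDegree h _) (rowT_totalDegree h _))

theorem gauss_shift (m c : ℕ) :
    2 * (∑ i ∈ Finset.range m, (i + c)) + m = m * m + 2 * m * c := by
  induction m with
  | zero => simp
  | succ m ih => rw [Finset.sum_range_succ]; nlinarith

theorem rowD_sum {n k : ℕ} (h2 : k < n) :
    ∑ r : Fin (n + 1), rowD n k r =
      (∑ j ∈ Finset.range (n + 1), j) + (k + 1) * (n + 1 - k) := by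
  obtain ⟨b, rfl⟩ : ∃ b, n = k + b := ⟨n - k, by omega⟩
  rw [← Finset.sum_range (fun r => rowD (k + b) k r), Finset.sum_range_succ, Finset.sum_range_add]
  have e1 : ∑ r ∈ Finset.range k, rowD (k + b) k r = ∑ r ∈ Finset.range k, (r + (b + 2)) := by
    refine Finset.sum_congr rfl fun r hr => ?_
    have := Finset.mem_range.1 hr
    rw [rowD, if_neg (by omega), if_pos this]
    omega
  have e2 : ∑ r ∈ Finset.range b, rowD (k + b) k (k + r) =
      ∑ r ∈ Finset.range b, (r + (k + 2)) := by
    refine Finset.sum_congr rfl fun r hr => ?_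
    have := Finset.mem_range.1 hr
    rw [rowD, if_neg (by omega), if_neg (by omega)]
    omega
  have e3 : rowD (k + b) k (k + b) = 1 := by simp [rowD]
  rw [e1, e2, e3, show k + b + 1 - k = b + 1 by omega]
  have g1 := gauss_shift k (b + 2)
  have g2 := gauss_shift b (k + 2)
  have g3 := gauss_shift (k + b + 1) 0
  simp only [add_zero] at g3
  nlinarith

/-- Specialization point: path variables `1`, apex variable `0`. -/
noncomputable def spec (n : ℕ) : MvPolynomial (Fin (n + 1)) ℚ →+* ℚ :=
  eval (fun c : Fin (n + 1) => if c.val < n then (1 : ℚ) else 0)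

theorem spec_yv {n i : ℕ} (hi : i ≤ n) : spec n (yv n i) = i := by
  have h : spec n (yv n i) = ∑ v ∈ iv n 0 i, (if v.val < n then (1 : ℚ) else 0) := by
    simp [spec, yv, lf, map_sum]
  rw [h, sum_iv _ (fun c => (c : ℚ)) (fun v hv => by simp [hv]) (Nat.zero_le i) hi]
  simp

theorem spec_rowT (n k r : ℕ) (i : ℕ) : spec n (rowT n k r (yv n i)) =
    (polyH n k (fun j => spec n (yv n j)) r).eval (spec n (yv n i)) := by
  have hz : spec n (X (Fin.last n)) = 0 := by simp [spec]
  have hz' : spec n (-X (Fin.last n)) = 0 := by rw [map_neg, hz, neg_zero]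
  rw [← Polynomial.coe_evalRingHom]
  unfold rowT polyH
  split_ifs <;> rw [antiT_map, antiT_map] <;> simp [hz]

theorem saitoM_det {n k : ℕ} (h2 : k < n) : (saitoM n k).det ≠ 0 := by
  rw [Matrix.det_succ_column _ (Fin.last n), Finset.sum_eq_single (Fin.last n)]
  · have hl : saitoM n k (Fin.last n) (Fin.last n) = X (Fin.last n) := by
      rw [saitoM, if_pos (by simp)]
    rw [hl]
    refine mul_ne_zero (mul_ne_zero (pow_ne_zero _ (by simp)) (X_ne_zero _)) ?_
    intro h0
    have h1 := congrArg (spec n) h0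
    rw [map_zero, RingHom.map_det] at h1
    obtain ⟨v, hv, hv0⟩ := Matrix.exists_vecMul_eq_zero_iff.2 h1
    apply hv
    let w : ℕ → ℚ := fun r => if h : r < n then v ⟨r, h⟩ else 0
    have key := polyH_indep h2 (fun j => spec n (yv n j)) (fun i hi j hj hij => by
      simp only [spec_yv hi, spec_yv hj] at hij
      exact_mod_cast hij) w (fun c hc => by
        have h3 := congrFun hv0 ⟨c, hc⟩
        simp only [Matrix.vecMul, dotProduct, Pi.zero_apply] at h3
        rw [← h3, Finset.sum_range]
        refine Finset.sum_congr rfl fun r _ => ?_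
        have hr := r.2
        simp only [w, hr, dif_pos, Fin.eta]
        congr 1
        simp only [RingHom.mapMatrix_apply, Matrix.map_apply, Matrix.submatrix_apply,
          Fin.succAbove_last]
        rw [saitoM, if_neg (by simp; omega), if_neg (by simp; omega), map_sub, spec_rowT,
          spec_rowT]
        rfl)
    ext1 r
    have := key r r.2
    simpa [w] using this
  · intro r _ hr
    have : r.val ≠ n := fun h => hr (Fin.ext h)
    rw [saitoM, if_neg this, if_pos (by simp)]
    ring
  · simp

end Final

/-- For `1 < k < n`, the connected subgraph arrangement of the
path-with-triangle graph `Δ_{n,k}` (on the `n+1` vertices `[n+1]`) is free: its module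
of `𝒜_{Δ_{n,k}}`-derivations is a free module over `ℚ[x_1,…,x_{n+1}]`. -/
theorem csa_pathTriangle_free (n k : ℕ) (h1 : 1 < k) (h2 : k < n) :
    Module.Free (MvPolynomial (Fin (n + 1)) ℚ) (derModule (pathTriangle n k)) := by
  exact saito (pathTriangle n k) (saitoM n k) (fun r => rowD n k r)
    (fun r I hI => saitoM_mem h1 h2 r I hI) saitoM_totalDegree
    ((rowD_sum h2).le.trans (card_connFin h1 h2)) (saitoM_det h2)
end
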